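/- Let (R, m) be a Noetherian local ring, M a finitely generated R-module with depth_R(M) ≥ 1 and dim M ≥ 3, and assume M has a canonical module. Then m is an attached prime of H_m^{dim M - 1}(M) if and only if depth of the canonical module of the m-adic completion of M over the completion of R equals 2. -/

import Mathlib

open CategoryTheory IsLocalRing Pointwise

noncomputable section

/-- `E` is an injective hull of `S ⧸ J` over `S`. -/
def IsInjHull (S : Type) [CommRing S] (J : Ideal S) (E : Type) [AddCommGroup E]
    [Module S E] : Prop :=
  Module.Injective S E ∧
    ∃ f : (S ⧸ J) →ₗ[S] E, Function.Injective f ∧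
      ∀ N : Submodule S E, N ≠ ⊥ → N ⊓ LinearMap.range f ≠ ⊥

/-- Local cohomology `H^i_J(M)`. -/
abbrev LC (S : Type) [CommRing S] (J : Ideal S) (i : ℕ) (M : ModuleCat S) : ModuleCat S :=
  (localCohomology J i).obj M

/-- Krull dimension of a module (dimension of its support). -/
def mdim (S : Type) [CommRing S] (M : Type) [AddCommGroup M] [Module S M] : WithBot ℕ∞ :=
  Order.krullDim (Module.support S M)

/-- Depth/grade of an ideal `J` on `M`: supremum of lengths of `M`-regular sequences in `J`. -/
def gradeI (S : Type) [CommRing S] (J : Ideal S) (M : Type) [AddCommGroup M]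
    [Module S M] : ℕ∞ :=
  sSup {n : ℕ∞ | ∃ rs : List S, (rs.length : ℕ∞) = n ∧ (∀ r ∈ rs, r ∈ J) ∧
    RingTheory.Sequence.IsRegular M rs}

/-- The local "height" of `M` at a prime `p`, i.e. `dim_{S_p} M_p`. -/
def htM (S : Type) [CommRing S] (M : Type) [AddCommGroup M] [Module S M]
    (p : PrimeSpectrum S) : WithBot ℕ∞ :=
  mdim (Localization.AtPrime p.asIdeal) (LocalizedModule p.asIdeal.primeCompl M)

/-- `ht_M(a) = inf { dim_{S_p} M_p : p ⊇ a, p ∈ Supp M }`. -/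
def htI (S : Type) [CommRing S] (M : Type) [AddCommGroup M] [Module S M]
    (a : Ideal S) : WithBot ℕ∞ :=
  sInf {d | ∃ p ∈ Module.support S M, a ≤ p.asIdeal ∧ d = htM S M p}

/-- Serre's condition `S_n` for the module `M`. -/
def Serre (S : Type) [CommRing S] (n : ℕ) (M : Type) [AddCommGroup M] [Module S M] : Prop :=
  ∀ (p : Ideal S) [p.IsPrime],
    min (n : WithBot ℕ∞)
        (mdim (Localization.AtPrime p) (LocalizedModule p.primeCompl M)) ≤
      (gradeI (Localization.AtPrime p) (IsLocalRing.maximalIdeal (Localization.AtPrime p))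
        (LocalizedModule p.primeCompl M) : ℕ∞)

/-- Attached primes of `M` (Macdonald): primes of the form `Ann(M ⧸ N)`. -/
def attachedPrimes (S : Type) [CommRing S] (M : Type) [AddCommGroup M] [Module S M] :
    Set (Ideal S) :=
  {p | p.IsPrime ∧ ∃ N : Submodule S M, p = Module.annihilator S (M ⧸ N)}

/-- `ω` is a canonical module of the `d`-dimensional module `M` over `(S, J)`:
its "Matlis dual" `Hom_S(ω, E)` is isomorphic to `H^d_J(M)`. -/
def IsCanonicalModule (S : Type) [CommRing S] (J : Ideal S) (d : ℕ)
    (M ω : ModuleCat S) : Prop :=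
  Module.Finite S ω ∧ ∃ E : ModuleCat S, IsInjHull S J ↥E ∧
    Nonempty ((↥ω →ₗ[S] ↥E) ≃ₗ[S] ↥(LC S J d M))

/-- `(S, J)` is quasi-Gorenstein: `H^d_J(S)` is an injective hull of `S ⧸ J`, `d = dim S`. -/
def IsQuasiGorensteinAt (S : Type) [CommRing S] (J : Ideal S) : Prop :=
  ∃ d : ℕ, ringKrullDim S = (d : WithBot ℕ∞) ∧
    ∃ E : ModuleCat S, IsInjHull S J ↥E ∧
      Nonempty (↥(LC S J d (ModuleCat.of S S)) ≃ₗ[S] ↥E)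

/-- Totally reflexive modules. -/
def TotallyReflexive (S : Type) [CommRing S] (M : ModuleCat S) : Prop :=
  Module.Finite S ↥M ∧ Module.IsReflexive S ↥M ∧
    ∀ i : ℕ, 0 < i →
      Subsingleton ↥(((Ext S (ModuleCat S) i).obj (Opposite.op M)).obj (ModuleCat.of S S)) ∧
      Subsingleton ↥(((Ext S (ModuleCat S) i).obj
        (Opposite.op (ModuleCat.of S (Module.Dual S ↥M)))).obj (ModuleCat.of S S))

/-- `G`-dimension at most `n`. -/
def GdimLE (S : Type) [CommRing S] : ℕ → ModuleCat S → Prop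
  | 0, M => TotallyReflexive S M
  | n + 1, M => ∃ (G : ModuleCat S) (f : ↥G →ₗ[S] ↥M), Function.Surjective f ∧
      TotallyReflexive S G ∧ GdimLE S n (ModuleCat.of S (LinearMap.ker f))

/-- Injective dimension at most `n`. -/
def InjDimLE (S : Type) [CommRing S] : ℕ → ModuleCat S → Prop
  | 0, M => Module.Injective S ↥M
  | n + 1, M => ∃ (E : ModuleCat S) (f : ↥M →ₗ[S] ↥E), Function.Injective f ∧
      Module.Injective S ↥E ∧ InjDimLE S n (ModuleCat.of S (↥E ⧸ LinearMap.range f))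

/-- Injective dimension, as an element of `ℕ∞`. -/
def injDim (S : Type) [CommRing S] (M : ModuleCat S) : ℕ∞ :=
  sInf {n : ℕ∞ | ∃ k : ℕ, (k : ℕ∞) = n ∧ InjDimLE S k M}

/-- Minimal number of generators. -/
def genNumber (S : Type) [CommRing S] (M : Type) [AddCommGroup M] [Module S M] : ℕ∞ :=
  sInf {n : ℕ∞ | ∃ s : Finset M, (s.card : ℕ∞) = n ∧ Submodule.span S (↑s : Set M) = ⊤}

/-- The socle `0 :_M J`. -/
def socle (S : Type) [CommRing S] (J : Ideal S) (M : Type) [AddCommGroup M] [Module S M] :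
    Submodule S M :=
  ⨅ r ∈ J, LinearMap.ker (LinearMap.lsmul S M r)

/-- Limit closure of the sequence `x` on `M`. -/
def limClo (S : Type) [CommRing S] {v : ℕ} (x : Fin v → S) (M : Type) [AddCommGroup M]
    [Module S M] : Submodule S M :=
  ⨆ t : ℕ, (Ideal.span (Set.range fun i => x i ^ (t + 1)) • (⊤ : Submodule S M)).comap
      (LinearMap.lsmul S M ((∏ i, x i) ^ t))

end

/-- Krull dimension of a ring, valued in `WithBot ℕ∞`. -/
noncomputable def rdim (S : Type) [CommRing S] : WithBot ℕ∞ :=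
  Order.krullDim (PrimeSpectrum S)

noncomputable section ExtComparison

open Abelian Limits

variable {R : Type} [CommRing R] {X X' Y : ModuleCat.{0} R}

/-- The submodule of `n`-cocycles of the complex `Hom(P, Y)`. -/
def extCocycles (P : ProjectiveResolution X) (Y : ModuleCat.{0} R) (n : ℕ) :
    Submodule R (P.complex.X n ⟶ Y) where
  carrier := {f | P.complex.d (n + 1) n ≫ f = 0}
  add_mem' {a b} ha hb := by
    simp only [Set.mem_ofPred_eq] at *
    rw [Preadditive.comp_add, ha, hb, add_zero]
  zero_mem' := by simp
  smul_mem' r f hf := by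
    simp only [Set.mem_ofPred_eq] at *
    rw [Linear.comp_smul, hf, smul_zero]

theorem mem_extCocycles {P : ProjectiveResolution X} {n : ℕ} {f : P.complex.X n ⟶ Y} :
    f ∈ extCocycles P Y n ↔ P.complex.d (n + 1) n ≫ f = 0 := Iff.rfl

/-- The class in `Abelian.Ext` of a cocycle. -/
def newExtMk (P : ProjectiveResolution X) (Y : ModuleCat.{0} R) (n : ℕ) :
    extCocycles P Y n →ₗ[R] Abelian.Ext X Y n where
  toFun f := P.extMk f.1 (n + 1) rfl (mem_extCocycles.1 f.2)
  map_add' f g := (P.add_extMk _ _ _ _ _ _).symm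
  map_smul' r f := by
    rw [Ext.smul_eq_comp_mk₀, P.extMk_comp_mk₀]
    congr 1

theorem newExtMk_surjective (P : ProjectiveResolution X) (Y : ModuleCat.{0} R) (n : ℕ) :
    Function.Surjective (newExtMk P Y n) := by
  intro α
  obtain ⟨f, hf, rfl⟩ := P.extMk_surjective α (n + 1) rfl
  exact ⟨⟨f, hf⟩, rfl⟩

theorem newExtMk_eq_zero_iff (P : ProjectiveResolution X) (Y : ModuleCat.{0} R) (n : ℕ)
    (f : extCocycles P Y n) :
    newExtMk P Y n f = 0 ↔
      ∃ g : P.complex.X ((ComplexShape.down ℕ).next n) ⟶ Y, P.complex.d n _ ≫ g = f.1 := by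
  cases n with
  | succ p =>
    have : (ComplexShape.down ℕ).next (p + 1) = p := by simp
    rw [this]
    exact P.extMk_eq_zero_iff f.1 _ rfl (mem_extCocycles.1 f.2) p rfl
  | zero =>
    constructor
    · intro h
      refine ⟨0, ?_⟩
      rw [comp_zero]
      change P.extMk f.1 _ rfl (mem_extCocycles.1 f.2) = 0 at h
      rw [← P.extEquivCohomologyClass.apply_eq_iff_eq,
        ProjectiveResolution.extEquivCohomologyClass_extMk,
        ProjectiveResolution.extEquivCohomologyClass_zero,
        CochainComplex.HomComplex.CohomologyClass.mk_eq_zero_iff,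
        CochainComplex.HomComplex.Cocycle.toSingleMk_mem_coboundaries_iff _ _ _ _ _ 1 (by simp)]
        at h
      obtain ⟨g, hg⟩ := h
      have hz : IsZero (P.cochainComplex.X 1) := by
        exact CochainComplex.isZero_of_isStrictlyLE _ 0 1 (by lia)
      rw [hz.eq_of_src g 0, comp_zero] at hg
      rw [← cancel_epi (P.cochainComplexXIso (-(0:ℕ)) 0 rfl).hom, comp_zero]
      exact hg
    · rintro ⟨g, hg⟩
      have : P.complex.d 0 ((ComplexShape.down ℕ).next 0) = 0 :=
        P.complex.shape _ _ (by simp)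
      rw [this, zero_comp] at hg
      have : f = 0 := Subtype.ext hg.symm
      rw [this, map_zero]

theorem mk₀_comp_newExtMk {P : ProjectiveResolution X} {P' : ProjectiveResolution X'}
    {g : X' ⟶ X} (φ : ProjectiveResolution.Hom P' P g) (n : ℕ)
    (f : extCocycles P Y n) (f' : extCocycles P' Y n) (hf : f'.1 = φ.hom.f n ≫ f.1) :
    (Ext.mk₀ g).comp (newExtMk P Y n f) (zero_add _) = newExtMk P' Y n f' := by
  change (Ext.mk₀ g).comp (P.extMk f.1 _ rfl (mem_extCocycles.1 f.2)) (zero_add _) =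
    P'.extMk f'.1 _ rfl (mem_extCocycles.1 f'.2)
  rw [ProjectiveResolution.mk₀_comp_extMk f.1 _ rfl (mem_extCocycles.1 f.2) φ]
  congr 1
  exact hf.symm

end ExtComparison

noncomputable section OldExt

open Abelian Limits

variable {R : Type} [CommRing R] {X X' Y : ModuleCat.{0} R}

/-- The complex `Hom(P, Y)` as a complex in the opposite of the category of modules. -/
abbrev opHomComplex (P : ProjectiveResolution X) (Y : ModuleCat.{0} R) :
    ChainComplex (ModuleCat.{0} R)ᵒᵖ ℕ :=
  ((((linearYoneda R (ModuleCat.{0} R)).obj Y).rightOp.mapHomologicalComplex _).obj P.complex)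

/-- The inclusion of cocycles, seen in the opposite category. -/
def opCocyclesIncl (P : ProjectiveResolution X) (Y : ModuleCat.{0} R) (n : ℕ) :
    (opHomComplex P Y).X n ⟶ Opposite.op (ModuleCat.of R (extCocycles P Y n)) :=
  Quiver.Hom.op (X := ModuleCat.of R (extCocycles P Y n))
    (Y := ((linearYoneda R (ModuleCat.{0} R)).obj Y).obj (Opposite.op (P.complex.X n)))
    (ModuleCat.ofHom (Submodule.subtype (extCocycles P Y n)))

theorem d_opCocyclesIncl (P : ProjectiveResolution X) (Y : ModuleCat.{0} R) (n : ℕ) :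
    (opHomComplex P Y).d (n + 1) n ≫ opCocyclesIncl P Y n = 0 := by
  apply Quiver.Hom.unop_inj
  ext f
  exact f.2

/-- The map from cocycles to the dual of opcycles. -/
def cocyclesToOpcycles (P : ProjectiveResolution X) (Y : ModuleCat.{0} R) (n : ℕ) :
    (opHomComplex P Y).opcycles n ⟶ Opposite.op (ModuleCat.of R (extCocycles P Y n)) :=
  (opHomComplex P Y).descOpcycles (opCocyclesIncl P Y n) (n + 1) (by simp)
    (d_opCocyclesIncl P Y n)

/-- The class in the derived functor `Ext` of a cocycle. -/
def oldExtMk (P : ProjectiveResolution X) (Y : ModuleCat.{0} R) (n : ℕ) :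
    extCocycles P Y n →ₗ[R] ((Ext R (ModuleCat.{0} R) n).obj (Opposite.op X)).obj Y :=
  ((P.isoLeftDerivedObj ((linearYoneda R (ModuleCat.{0} R)).obj Y).rightOp n).hom ≫
    (opHomComplex P Y).homologyι n ≫ cocyclesToOpcycles P Y n).unop.hom

theorem oldExtMk_apply (P : ProjectiveResolution X) (Y : ModuleCat.{0} R) (n : ℕ)
    (f : extCocycles P Y n) :
    oldExtMk P Y n f =
      (P.isoLeftDerivedObj ((linearYoneda R (ModuleCat.{0} R)).obj Y).rightOp n).hom.unop.hom
        (((opHomComplex P Y).homologyι n).unop.hom ((cocyclesToOpcycles P Y n).unop.hom f)) :=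
  rfl

theorem pOpcycles_cocyclesToOpcycles (P : ProjectiveResolution X) (Y : ModuleCat.{0} R) (n : ℕ)
    (f : extCocycles P Y n) :
    ((opHomComplex P Y).pOpcycles n).unop.hom ((cocyclesToOpcycles P Y n).unop.hom f) = f.1 := by
  have : (opHomComplex P Y).pOpcycles n ≫ cocyclesToOpcycles P Y n = opCocyclesIncl P Y n := by
    simp [cocyclesToOpcycles]
  have := congrArg (fun z => z.unop.hom f) this
  exact this

theorem pOpcycles_unop_injective (P : ProjectiveResolution X) (Y : ModuleCat.{0} R) (n : ℕ) :
    Function.Injective ((opHomComplex P Y).pOpcycles n).unop.hom :=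
  (ModuleCat.mono_iff_injective _).1 inferInstance

theorem oldExtMk_surjective (P : ProjectiveResolution X) (Y : ModuleCat.{0} R) (n : ℕ) :
    Function.Surjective (oldExtMk P Y n) := by
  intro α
  obtain ⟨β, rfl⟩ := (ModuleCat.epi_iff_surjective (P.isoLeftDerivedObj
    ((linearYoneda R (ModuleCat.{0} R)).obj Y).rightOp n).hom.unop).1 inferInstance α
  obtain ⟨γ, rfl⟩ := (ModuleCat.epi_iff_surjective ((opHomComplex P Y).homologyι n).unop).1
    inferInstance β
  have hz : P.complex.d (n + 1) n ≫
      (((opHomComplex P Y).pOpcycles n).unop.hom γ : P.complex.X n ⟶ Y) = 0 := by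
    have : (opHomComplex P Y).d (n + 1) n ≫ (opHomComplex P Y).pOpcycles n = 0 :=
      (opHomComplex P Y).d_pOpcycles _ _
    exact congrArg (fun z => z.unop.hom γ) this
  refine ⟨⟨((opHomComplex P Y).pOpcycles n).unop.hom γ, hz⟩, ?_⟩
  rw [oldExtMk_apply]
  congr 2
  apply pOpcycles_unop_injective
  rw [pOpcycles_cocyclesToOpcycles]

theorem oldExtMk_eq_zero_iff (P : ProjectiveResolution X) (Y : ModuleCat.{0} R) (n : ℕ)
    (f : extCocycles P Y n) :
    oldExtMk P Y n f = 0 ↔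
      ∃ g : P.complex.X ((ComplexShape.down ℕ).next n) ⟶ Y, P.complex.d n _ ≫ g = f.1 := by
  have h1 : oldExtMk P Y n f = 0 ↔
      ((opHomComplex P Y).homologyι n).unop.hom ((cocyclesToOpcycles P Y n).unop.hom f) = 0 := by
    rw [oldExtMk_apply]
    exact map_eq_zero_iff _ ((ModuleCat.mono_iff_injective (P.isoLeftDerivedObj
      ((linearYoneda R (ModuleCat.{0} R)).obj Y).rightOp n).hom.unop).1 inferInstance)
  have hex : (ShortComplex.mk _ _ ((opHomComplex P Y).homologyι_comp_fromOpcycles n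
      ((ComplexShape.down ℕ).next n))).Exact :=
    ShortComplex.exact_of_f_is_kernel _
      ((opHomComplex P Y).homologyIsKernel n ((ComplexShape.down ℕ).next n) rfl)
  have hex' := (ShortComplex.moduleCat_exact_iff _).1 hex.unop
  have key : ∀ g : P.complex.X ((ComplexShape.down ℕ).next n) ⟶ Y,
      ((opHomComplex P Y).pOpcycles n).unop.hom
        (((opHomComplex P Y).fromOpcycles n ((ComplexShape.down ℕ).next n)).unop.hom g) =
      P.complex.d n _ ≫ g := by
    intro g
    exact congrArg (fun z => z.unop.hom g) ((opHomComplex P Y).p_fromOpcycles n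
      ((ComplexShape.down ℕ).next n))
  rw [h1]
  constructor
  · intro h
    obtain ⟨g, hg⟩ := hex' _ h
    refine ⟨g, ?_⟩
    refine (key g).symm.trans ?_
    refine Eq.trans ?_ (pOpcycles_cocyclesToOpcycles P Y n f)
    exact congrArg _ hg
  · rintro ⟨g, hg⟩
    have : (cocyclesToOpcycles P Y n).unop.hom f =
        ((opHomComplex P Y).fromOpcycles n ((ComplexShape.down ℕ).next n)).unop.hom g := by
      apply pOpcycles_unop_injective
      rw [key, hg, pOpcycles_cocyclesToOpcycles]
    rw [this]
    exact congrArg (fun z => z.unop.hom g) ((opHomComplex P Y).homologyι_comp_fromOpcycles n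
      ((ComplexShape.down ℕ).next n))

theorem map_oldExtMk {P : ProjectiveResolution X} {P' : ProjectiveResolution X'}
    {g : X' ⟶ X} (φ : ProjectiveResolution.Hom P' P g) (n : ℕ)
    (f : extCocycles P Y n) (f' : extCocycles P' Y n) (hf : f'.1 = φ.hom.f n ≫ f.1) :
    (((Ext R (ModuleCat.{0} R) n).map g.op).app Y).hom (oldExtMk P Y n f) =
      oldExtMk P' Y n f' := by
  have h1 := ProjectiveResolution.isoLeftDerivedObj_hom_naturality g P' P φ.hom
    (by simpa using φ.hom_f_zero_comp_π_f_zero) ((linearYoneda R (ModuleCat.{0} R)).obj Y).rightOp n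
  have h1' := congrArg (fun z => z.unop.hom
    (((opHomComplex P Y).homologyι n).unop.hom ((cocyclesToOpcycles P Y n).unop.hom f))) h1
  refine Eq.trans h1' ?_
  rw [oldExtMk_apply]
  change (P'.isoLeftDerivedObj ((linearYoneda R (ModuleCat.{0} R)).obj Y).rightOp n).hom.unop.hom
    _ = _
  congr 1
  have h2 := HomologicalComplex.homologyι_naturality
    ((((linearYoneda R (ModuleCat.{0} R)).obj Y).rightOp.mapHomologicalComplex _).map φ.hom) n
  have h2' := congrArg (fun z => z.unop.hom ((cocyclesToOpcycles P Y n).unop.hom f)) h2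
  refine Eq.trans h2' ?_
  change ((opHomComplex P' Y).homologyι n).unop.hom _ = _
  congr 1
  apply pOpcycles_unop_injective
  rw [pOpcycles_cocyclesToOpcycles, hf]
  have h3 := HomologicalComplex.p_opcyclesMap
    ((((linearYoneda R (ModuleCat.{0} R)).obj Y).rightOp.mapHomologicalComplex _).map φ.hom) n
  have h3' := congrArg (fun z => z.unop.hom ((cocyclesToOpcycles P Y n).unop.hom f)) h3
  refine Eq.trans h3' ?_
  exact congrArg (fun z => φ.hom.f n ≫ z) (pOpcycles_cocyclesToOpcycles P Y n f)

end OldExt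

noncomputable section ExtEquiv

open Abelian Limits

variable {R : Type} [CommRing R] {X X' : ModuleCat.{0} R}

/-- Comparison of the derived functor `Ext` and of `Abelian.Ext`. -/
def extComparison (X Y : ModuleCat.{0} R) (n : ℕ) :
    ((Ext R (ModuleCat.{0} R) n).obj (Opposite.op X)).obj Y ≃ₗ[R] Abelian.Ext X Y n :=
  ((oldExtMk (projectiveResolution X) Y n).quotKerEquivOfSurjective
    (oldExtMk_surjective _ Y n)).symm ≪≫ₗ
  Submodule.quotEquivOfEq _ _ (by
    ext f
    rw [LinearMap.mem_ker, LinearMap.mem_ker, oldExtMk_eq_zero_iff, newExtMk_eq_zero_iff]) ≪≫ₗ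
  ((newExtMk (projectiveResolution X) Y n).quotKerEquivOfSurjective
    (newExtMk_surjective _ Y n))

theorem extComparison_oldExtMk (X Y : ModuleCat.{0} R) (n : ℕ)
    (f : extCocycles (projectiveResolution X) Y n) :
    extComparison X Y n (oldExtMk _ Y n f) = newExtMk _ Y n f := by
  have : ((oldExtMk (projectiveResolution X) Y n).quotKerEquivOfSurjective
      (oldExtMk_surjective _ Y n)).symm (oldExtMk _ Y n f) = Submodule.Quotient.mk f := by
    rw [LinearEquiv.symm_apply_eq]
    rfl
  simp only [extComparison, LinearEquiv.trans_apply]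
  rw [this]
  rfl

theorem extComparison_naturality (g : X' ⟶ X) (Y : ModuleCat.{0} R) (n : ℕ)
    (α : ((Ext R (ModuleCat.{0} R) n).obj (Opposite.op X)).obj Y) :
    extComparison X' Y n ((((Ext R (ModuleCat.{0} R) n).map g.op).app Y).hom α) =
      (Ext.mk₀ g).comp (extComparison X Y n α) (zero_add _) := by
  obtain ⟨f, rfl⟩ := oldExtMk_surjective (projectiveResolution X) Y n α
  let φ : ProjectiveResolution.Hom (projectiveResolution X') (projectiveResolution X) g :=
    { hom := ProjectiveResolution.lift g _ _
      hom_f_zero_comp_π_f_zero := ProjectiveResolution.lift_commutes_zero _ _ _ }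
  let f' : extCocycles (projectiveResolution X') Y n := ⟨φ.hom.f n ≫ f.1, by
    have := mem_extCocycles.1 f.2
    rw [mem_extCocycles, ← φ.hom.comm_assoc, this, comp_zero]⟩
  rw [map_oldExtMk φ n f f' rfl, extComparison_oldExtMk, extComparison_oldExtMk,
    mk₀_comp_newExtMk φ n f f' rfl]

end ExtEquiv

noncomputable section LocCoh

open Abelian Limits

variable {R : Type} [CommRing R] (J : Ideal R) (i : ℕ) (M : Type) [AddCommGroup M] [Module R M]

/-- The canonical map `R ⧸ J ^ l ⟶ R ⧸ J ^ k` for `k ≤ l`. -/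
def quotPowMap {k l : ℕ} (h : k ≤ l) :
    ModuleCat.of R (R ⧸ J ^ l) ⟶ ModuleCat.of R (R ⧸ J ^ k) :=
  ModuleCat.ofHom (Submodule.mapQ _ _ LinearMap.id (Ideal.pow_le_pow_right h))

theorem quotPowMap_self (k : ℕ) : quotPowMap J (le_refl k) = 𝟙 _ := by
  ext
  rfl

theorem quotPowMap_comp {k l p : ℕ} (h : k ≤ l) (h' : l ≤ p) :
    quotPowMap J h' ≫ quotPowMap J h = quotPowMap J (h.trans h') := by
  ext
  rfl

/-- The transition maps in the direct system computing local cohomology. -/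
def extTransition (k l : ℕ) (h : k ≤ l) :
    Abelian.Ext (ModuleCat.of R (R ⧸ J ^ k)) (ModuleCat.of R M) i →ₗ[R]
      Abelian.Ext (ModuleCat.of R (R ⧸ J ^ l)) (ModuleCat.of R M) i where
  toFun α := (Ext.mk₀ (quotPowMap J h)).comp α (zero_add i)
  map_add' := by simp
  map_smul' := by simp

theorem extTransition_apply (k l : ℕ) (h : k ≤ l)
    (α : Abelian.Ext (ModuleCat.of R (R ⧸ J ^ k)) (ModuleCat.of R M) i) :
    extTransition J i M k l h α = (Ext.mk₀ (quotPowMap J h)).comp α (zero_add i) := rfl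

instance : DirectedSystem
    (fun k : ℕ => Abelian.Ext (ModuleCat.of R (R ⧸ J ^ k)) (ModuleCat.of R M) i)
    (fun k l h => extTransition J i M k l h) where
  map_self k x := by
    rw [extTransition_apply, quotPowMap_self]
    simp
  map_map k l p h h' x := by
    simp only [extTransition_apply]
    rw [← quotPowMap_comp J h h', ← Ext.mk₀_comp_mk₀]
    exact (Ext.comp_assoc _ _ _ (zero_add _) (zero_add _) (by simp)).symm

/-- Local cohomology as a direct limit of `Abelian.Ext` modules. -/
abbrev LocCoh : Type :=
  Module.DirectLimit
    (fun k : ℕ => Abelian.Ext (ModuleCat.of R (R ⧸ J ^ k)) (ModuleCat.of R M) i)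
    (fun k l h => extTransition J i M k l h)

/-- The structure maps of `LocCoh`. -/
abbrev LocCoh.of (k : ℕ) :
    Abelian.Ext (ModuleCat.of R (R ⧸ J ^ k)) (ModuleCat.of R M) i →ₗ[R] LocCoh J i M :=
  Module.DirectLimit.of R ℕ
    (fun k : ℕ => Abelian.Ext (ModuleCat.of R (R ⧸ J ^ k)) (ModuleCat.of R M) i)
    (fun k l h => extTransition J i M k l h) k

theorem nonempty_locCoh_equiv (Y : ModuleCat.{0} R) :
    Nonempty (LocCoh J i Y ≃ₗ[R] (localCohomology J i).obj Y) := by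
  let D := localCohomology.diagram (localCohomology.idealPowersDiagram J) i
  let F := D ⋙ (evaluation _ _).obj Y
  have hcD : IsColimit (colimit.cocone D) := colimit.isColimit D
  let c : Cocone F := ((evaluation _ _).obj Y).mapCocone (colimit.cocone D)
  have hc : IsColimit c := isColimitOfPreserves ((evaluation _ _).obj Y) hcD
  have hpt : (c.pt : ModuleCat R) = (localCohomology J i).obj Y := rfl
  let e : ∀ k : ℕ, F.obj (Opposite.op (Opposite.op k)) ≃ₗ[R]
      Abelian.Ext (ModuleCat.of R (R ⧸ J ^ k)) Y i :=
    fun k => extComparison (ModuleCat.of R (R ⧸ J ^ k)) Y i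
  let ι : ∀ k : ℕ, F.obj (Opposite.op (Opposite.op k)) →ₗ[R] c.pt :=
    fun k => (c.ι.app (Opposite.op (Opposite.op k))).hom
  have he : ∀ (k l : ℕ) (h : k ≤ l) (x : F.obj (Opposite.op (Opposite.op k))),
      e l ((F.map (homOfLE h).op.op).hom x) = extTransition J i Y k l h (e k x) := by
    intro k l h x
    exact extComparison_naturality (quotPowMap J h) Y i x
  let φ : LocCoh J i Y →ₗ[R] c.pt := Module.DirectLimit.lift R ℕ _ _
    (fun k => (ι k).comp (e k).symm.toLinearMap) (by
      intro k l h x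
      obtain ⟨y, rfl⟩ := (e k).surjective x
      simp only [LinearMap.comp_apply, LinearEquiv.coe_coe]
      rw [← he, (e l).symm_apply_apply, (e k).symm_apply_apply]
      exact congrArg (fun z => z.hom y) (c.w (homOfLE h).op.op))
  refine ⟨LinearEquiv.ofBijective φ ⟨?_, ?_⟩⟩
  · rw [injective_iff_map_eq_zero]
    intro a ha
    obtain ⟨k, x, rfl⟩ := Module.DirectLimit.exists_of a
    rw [Module.DirectLimit.lift_of] at ha
    obtain ⟨y, rfl⟩ := (e k).surjective x
    simp only [LinearMap.comp_apply, LinearEquiv.coe_coe, (e k).symm_apply_apply] at ha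
    have ha' : c.ι.app (Opposite.op (Opposite.op k)) y =
        c.ι.app (Opposite.op (Opposite.op k)) (0 : F.obj _) := by
      rw [map_zero]
      exact ha
    obtain ⟨⟨⟨l⟩⟩, f, g, hfg⟩ := Concrete.isColimit_exists_of_rep_eq F hc _ _ ha'
    have hl : k ≤ l := leOfHom f.unop.unop
    have h1 : (F.map (homOfLE hl).op.op).hom y = 0 := by
      have : f = (homOfLE hl).op.op := Subsingleton.elim _ _
      rw [← this]
      rw [map_zero] at hfg
      exact hfg
    have h2 := he k l hl y
    rw [h1, map_zero] at h2
    rw [← Module.DirectLimit.of_f (hij := hl), ← h2, map_zero]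
  · intro a
    obtain ⟨⟨⟨k⟩⟩, y, rfl⟩ := Concrete.isColimit_exists_rep F hc a
    refine ⟨LocCoh.of J i Y k (e k y), ?_⟩
    rw [Module.DirectLimit.lift_of]
    simp only [LinearMap.comp_apply, LinearEquiv.coe_coe, (e k).symm_apply_apply]
    rfl

end LocCoh

noncomputable section LocCohProps

open Abelian Limits

variable {R : Type} [CommRing R] (J : Ideal R) (i : ℕ) {M N P : Type}
  [AddCommGroup M] [Module R M] [AddCommGroup N] [Module R N] [AddCommGroup P] [Module R P]

namespace LocCoh

theorem exists_of (a : LocCoh J i M) : ∃ k α, of J i M k α = a :=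
  Module.DirectLimit.exists_of a

theorem of_extTransition {k l : ℕ} (h : k ≤ l)
    (α : Abelian.Ext (ModuleCat.of R (R ⧸ J ^ k)) (ModuleCat.of R M) i) :
    of J i M l (extTransition J i M k l h α) = of J i M k α :=
  Module.DirectLimit.of_f

theorem exists_extTransition_eq_zero {k : ℕ}
    {α : Abelian.Ext (ModuleCat.of R (R ⧸ J ^ k)) (ModuleCat.of R M) i}
    (h : of J i M k α = 0) : ∃ l, ∃ h : k ≤ l, extTransition J i M k l h α = 0 :=
  Module.DirectLimit.of.zero_exact h

theorem extTransition_comp {n p : ℕ} (hp : i + n = p) {k l : ℕ} (h : k ≤ l)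
    (α : Abelian.Ext (ModuleCat.of R (R ⧸ J ^ k)) (ModuleCat.of R M) i)
    (β : Abelian.Ext (ModuleCat.of R M) (ModuleCat.of R N) n) :
    extTransition J p N k l h (α.comp β hp) = (extTransition J i M k l h α).comp β hp := by
  rw [extTransition_apply, extTransition_apply]
  exact (Ext.comp_assoc _ _ _ (zero_add _) hp (by simp [hp])).symm

/-- Composition with an `Ext` class. -/
def compExt {n p : ℕ} (hp : i + n = p) (β : Abelian.Ext (ModuleCat.of R M) (ModuleCat.of R N) n) :
    LocCoh J i M →ₗ[R] LocCoh J p N :=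
  Module.DirectLimit.lift R ℕ _ _
    (fun k => (of J p N k).comp
      ({ toFun := fun α => α.comp β hp
         map_add' := by simp
         map_smul' := by simp } :
        Abelian.Ext (ModuleCat.of R (R ⧸ J ^ k)) (ModuleCat.of R M) i →ₗ[R]
          Abelian.Ext (ModuleCat.of R (R ⧸ J ^ k)) (ModuleCat.of R N) p))
    (fun k l h α => by
      simp only [LinearMap.comp_apply, LinearMap.coe_mk, AddHom.coe_mk]
      rw [← extTransition_comp, of_extTransition])

theorem compExt_of {n p : ℕ} (hp : i + n = p)
    (β : Abelian.Ext (ModuleCat.of R M) (ModuleCat.of R N) n) {k : ℕ}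
    (α : Abelian.Ext (ModuleCat.of R (R ⧸ J ^ k)) (ModuleCat.of R M) i) :
    compExt J i hp β (of J i M k α) = of J p N k (α.comp β hp) := by
  rw [compExt]
  exact Module.DirectLimit.lift_of _ _ _

/-- Functoriality of local cohomology. -/
def map (f : M →ₗ[R] N) : LocCoh J i M →ₗ[R] LocCoh J i N :=
  compExt J i (add_zero i) (Ext.mk₀ (ModuleCat.ofHom f))

theorem map_of (f : M →ₗ[R] N) {k : ℕ}
    (α : Abelian.Ext (ModuleCat.of R (R ⧸ J ^ k)) (ModuleCat.of R M) i) :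
    map J i f (of J i M k α) =
      of J i N k (α.comp (Ext.mk₀ (ModuleCat.ofHom f)) (add_zero i)) :=
  compExt_of _ _ _ _ _

theorem map_id_apply (a : LocCoh J i M) : map J i (LinearMap.id : M →ₗ[R] M) a = a := by
  obtain ⟨k, α, rfl⟩ := exists_of J i a
  rw [map_of, ModuleCat.ofHom_id, Ext.comp_mk₀_id]

theorem map_comp_apply (f : M →ₗ[R] N) (g : N →ₗ[R] P) (a : LocCoh J i M) :
    map J i (g.comp f) a = map J i g (map J i f a) := by
  obtain ⟨k, α, rfl⟩ := exists_of J i a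
  rw [map_of, map_of, map_of, ModuleCat.ofHom_comp, ← Ext.mk₀_comp_mk₀]
  congr 1
  exact (Ext.comp_assoc _ _ _ (add_zero _) (add_zero _) (by simp)).symm

theorem map_lsmul (r : R) (a : LocCoh J i M) : map J i (LinearMap.lsmul R M r) a = r • a := by
  obtain ⟨k, α, rfl⟩ := exists_of J i a
  rw [map_of, ← map_smul, Ext.smul_eq_comp_mk₀]
  rfl

theorem exists_pow_smul_eq_zero (a : LocCoh J i M) : ∃ k, ∀ r ∈ J ^ k, r • a = 0 := by
  obtain ⟨k, α, rfl⟩ := exists_of J i a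
  refine ⟨k, fun r hr => ?_⟩
  rw [← map_smul]
  have h : r • (𝟙 (ModuleCat.of R (R ⧸ J ^ k))) = 0 := by
    ext
    simp only [ModuleCat.hom_smul, ModuleCat.hom_id, ModuleCat.hom_zero]
    change r • (Ideal.Quotient.mk (J ^ k) 1) = 0
    rw [← Ideal.Quotient.mk_eq_mk, ← Submodule.Quotient.mk_smul]
    simpa [Ideal.Quotient.eq_zero_iff_mem] using hr
  have : r • α = (Ext.mk₀ (r • 𝟙 (ModuleCat.of R (R ⧸ J ^ k)))).comp α (zero_add i) := by
    rw [Ext.mk₀_smul, Ext.smul_comp, Ext.mk₀_id_comp]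
  rw [this, h, Ext.mk₀_zero, Ext.zero_comp, map_zero]

theorem subsingleton_of_injective [Module.Injective R M] :
    Subsingleton (LocCoh J (i + 1) M) := by
  refine ⟨fun a b => ?_⟩
  have : CategoryTheory.Injective (ModuleCat.of R M) :=
    Module.injective_object_of_injective_module R M
  have h : ∀ a : LocCoh J (i + 1) M, a = 0 := by
    intro a
    obtain ⟨k, α, rfl⟩ := exists_of J _ a
    rw [Ext.eq_zero_of_injective α, map_zero]
  rw [h a, h b]

section Exact

variable {f : M →ₗ[R] N} {g : N →ₗ[R] P}

theorem shortExact_of (hf : Function.Injective f) (hfg : Function.Exact f g)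
    (hg : Function.Surjective g) :
    (ModuleCat.shortComplexOfCompEqZero f g hfg.linearMap_comp_eq_zero).ShortExact where
  exact := (ShortComplex.ShortExact.moduleCat_exact_iff_function_exact _).2 hfg
  mono_f := (ModuleCat.mono_iff_injective _).2 hf
  epi_g := (ModuleCat.epi_iff_surjective _).2 hg

theorem exact_map (hf : Function.Injective f) (hfg : Function.Exact f g)
    (hg : Function.Surjective g) : Function.Exact (map J i f) (map J i g) := by
  have hS := shortExact_of hf hfg hg
  intro a
  constructor
  · intro ha
    obtain ⟨k, α, rfl⟩ := exists_of J i a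
    rw [map_of] at ha
    obtain ⟨l, h, hl⟩ := exists_extTransition_eq_zero J i ha
    rw [extTransition_comp] at hl
    obtain ⟨β, hβ⟩ := Ext.covariant_sequence_exact₂ _ hS _ hl
    refine ⟨of J i M l β, ?_⟩
    rw [← of_extTransition J i h, map_of]
    exact congrArg _ hβ
  · rintro ⟨b, rfl⟩
    rw [← map_comp_apply, hfg.linearMap_comp_eq_zero]
    obtain ⟨k, α, rfl⟩ := exists_of J i b
    rw [map_of]
    simp

theorem exists_connecting (hf : Function.Injective f) (hfg : Function.Exact f g)
    (hg : Function.Surjective g) :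
    ∃ δ : LocCoh J i P →ₗ[R] LocCoh J (i + 1) M,
      Function.Exact (map J i g) δ ∧ Function.Exact δ (map J (i + 1) f) := by
  have hS := shortExact_of hf hfg hg
  refine ⟨compExt J i rfl hS.extClass, fun a => ⟨fun ha => ?_, ?_⟩, fun a => ⟨fun ha => ?_, ?_⟩⟩
  · obtain ⟨k, α, rfl⟩ := exists_of J i a
    rw [compExt_of] at ha
    obtain ⟨l, h, hl⟩ := exists_extTransition_eq_zero J _ ha
    rw [extTransition_comp] at hl
    obtain ⟨β, hβ⟩ := Ext.covariant_sequence_exact₃ _ hS _ _ hl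
    refine ⟨of J i N l β, ?_⟩
    rw [← of_extTransition J i h, map_of]
    exact congrArg _ hβ
  · rintro ⟨b, rfl⟩
    obtain ⟨k, α, rfl⟩ := exists_of J i b
    rw [map_of, compExt_of, Ext.comp_assoc _ _ _ (add_zero _) (zero_add _) (by simp)]
    have : (Ext.mk₀ (ModuleCat.ofHom g)).comp hS.extClass (zero_add 1) = 0 := hS.comp_extClass
    rw [this, Ext.comp_zero, map_zero]
  · obtain ⟨k, α, rfl⟩ := exists_of J _ a
    rw [map_of] at ha
    obtain ⟨l, h, hl⟩ := exists_extTransition_eq_zero J _ ha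
    rw [extTransition_comp] at hl
    obtain ⟨β, hβ⟩ := Ext.covariant_sequence_exact₁ _ hS _ hl rfl
    refine ⟨of J i P l β, ?_⟩
    rw [← of_extTransition J _ h, compExt_of]
    exact congrArg _ hβ
  · rintro ⟨b, rfl⟩
    obtain ⟨k, α, rfl⟩ := exists_of J i b
    rw [compExt_of, map_of, Ext.comp_assoc _ _ _ rfl (add_zero 1) (by simp)]
    have : hS.extClass.comp (Ext.mk₀ (ModuleCat.ofHom f)) (add_zero 1) = 0 := hS.extClass_comp
    rw [this, Ext.comp_zero, map_zero]

end Exact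

/-- The value at `1` of a class of degree `0`. -/
def evalOne : LocCoh J 0 M →ₗ[R] M :=
  Module.DirectLimit.lift R ℕ _ _
    (fun k =>
      ({ toFun := fun α => (Ext.linearEquiv₀ (R := R) α).hom (Ideal.Quotient.mk (J ^ k) 1)
         map_add' := by simp
         map_smul' := by simp } :
        Abelian.Ext (ModuleCat.of R (R ⧸ J ^ k)) (ModuleCat.of R M) 0 →ₗ[R] M))
    (fun k l h α => by
      obtain ⟨β, rfl⟩ := (Ext.linearEquiv₀ (R := R)).symm.surjective α
      have : extTransition J 0 M k l h ((Ext.linearEquiv₀ (R := R)).symm β) =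
        (Ext.linearEquiv₀ (R := R)).symm (quotPowMap J h ≫ β) := Ext.mk₀_comp_mk₀ _ _
      simp only [LinearMap.coe_mk, AddHom.coe_mk]
      rw [this, LinearEquiv.apply_symm_apply, LinearEquiv.apply_symm_apply]
      rfl)

theorem evalOne_of {k : ℕ} (β : ModuleCat.of R (R ⧸ J ^ k) ⟶ ModuleCat.of R M) :
    evalOne J (of J 0 M k (Ext.mk₀ β)) = β.hom (Ideal.Quotient.mk (J ^ k) 1) := by
  refine (Module.DirectLimit.lift_of _ _ _).trans ?_
  change (Ext.linearEquiv₀ (R := R) ((Ext.linearEquiv₀ (R := R)).symm β)).hom _ = _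
  rw [LinearEquiv.apply_symm_apply]

theorem exists_of_mk₀ (a : LocCoh J 0 M) :
    ∃ (k : ℕ) (β : ModuleCat.of R (R ⧸ J ^ k) ⟶ ModuleCat.of R M),
      of J 0 M k (Ext.mk₀ β) = a := by
  obtain ⟨k, α, rfl⟩ := exists_of J 0 a
  obtain ⟨β, rfl⟩ := (Ext.linearEquiv₀ (R := R)).symm.surjective α
  exact ⟨k, β, rfl⟩

theorem evalOne_injective : Function.Injective (evalOne J (M := M)) := by
  rw [injective_iff_map_eq_zero]
  intro a ha
  obtain ⟨k, β, rfl⟩ := exists_of_mk₀ J a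
  rw [evalOne_of] at ha
  have : β = 0 := by
    ext
    exact ha
  rw [this, Ext.mk₀_zero, map_zero]

theorem evalOne_map (f : M →ₗ[R] N) (a : LocCoh J 0 M) :
    evalOne J (map J 0 f a) = f (evalOne J a) := by
  obtain ⟨k, β, rfl⟩ := exists_of_mk₀ J a
  rw [map_of, Ext.mk₀_comp_mk₀, evalOne_of, evalOne_of]
  rfl

theorem mem_range_evalOne_iff (x : M) :
    x ∈ LinearMap.range (evalOne J (M := M)) ↔ ∃ k, ∀ r ∈ J ^ k, r • x = 0 := by
  constructor
  · rintro ⟨a, rfl⟩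
    obtain ⟨k, hk⟩ := exists_pow_smul_eq_zero J 0 a
    refine ⟨k, fun r hr => ?_⟩
    rw [← map_smul, hk r hr, map_zero]
  · rintro ⟨k, hk⟩
    let β : (R ⧸ J ^ k) →ₗ[R] M := Submodule.liftQ (J ^ k) (LinearMap.toSpanSingleton R M x) hk
    refine ⟨of J 0 M k (Ext.mk₀ (ModuleCat.ofHom β)), ?_⟩
    rw [evalOne_of]
    exact one_smul R x

end LocCoh

end LocCohProps

section PowTorsion

variable {R : Type} [CommRing R] (J : Ideal R) {M N : Type}
  [AddCommGroup M] [Module R M] [AddCommGroup N] [Module R N]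

/-- `M` is `J`-power torsion. -/
def IsPowTorsion (M : Type) [AddCommGroup M] [Module R M] : Prop :=
  ∀ x : M, ∃ k, ∀ r ∈ J ^ k, r • x = 0

variable (M) in
/-- The submodule of elements killed by some power of `J`. -/
def powTorsion : Submodule R M where
  carrier := {x | ∃ k, ∀ r ∈ J ^ k, r • x = 0}
  zero_mem' := ⟨0, by simp⟩
  add_mem' := by
    rintro a b ⟨k, hk⟩ ⟨l, hl⟩
    refine ⟨k + l, fun r hr => ?_⟩
    rw [smul_add, hk r (Ideal.pow_le_pow_right (Nat.le_add_right k l) hr),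
      hl r (Ideal.pow_le_pow_right (Nat.le_add_left l k) hr), add_zero]
  smul_mem' := by
    rintro c x ⟨k, hk⟩
    refine ⟨k, fun r hr => ?_⟩
    rw [smul_comm, hk r hr, smul_zero]

theorem isPowTorsion_powTorsion : IsPowTorsion J (powTorsion J M) := by
  rintro ⟨x, k, hk⟩
  exact ⟨k, fun r hr => Subtype.ext (hk r hr)⟩

variable {J} in
theorem IsPowTorsion.of_surjective (h : IsPowTorsion J M) (f : M →ₗ[R] N)
    (hf : Function.Surjective f) : IsPowTorsion J N := by
  intro y
  obtain ⟨x, rfl⟩ := hf y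
  obtain ⟨k, hk⟩ := h x
  exact ⟨k, fun r hr => by rw [← map_smul, hk r hr, map_zero]⟩

variable {J} in
theorem IsPowTorsion.of_injective (h : IsPowTorsion J N) (f : M →ₗ[R] N)
    (hf : Function.Injective f) : IsPowTorsion J M := by
  intro x
  obtain ⟨k, hk⟩ := h (f x)
  exact ⟨k, fun r hr => hf (by rw [map_smul, hk r hr, map_zero])⟩

theorem exists_pow_le_annihilator_of_fg (P : Submodule R M) (hP : P.FG)
    (h : ∀ x ∈ P, ∃ k, ∀ r ∈ J ^ k, r • x = 0) : ∃ k, ∀ r ∈ J ^ k, ∀ x ∈ P, r • x = 0 := by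
  induction P, hP using Submodule.fg_induction with
  | singleton x =>
    obtain ⟨k, hk⟩ := h x (Submodule.mem_span_singleton_self x)
    refine ⟨k, fun r hr y hy => ?_⟩
    obtain ⟨a, rfl⟩ := Submodule.mem_span_singleton.1 hy
    rw [smul_comm, hk r hr, smul_zero]
  | sup P Q _ _ hP hQ =>
    obtain ⟨k, hk⟩ := hP (fun x hx => h x (Submodule.mem_sup_left hx))
    obtain ⟨l, hl⟩ := hQ (fun x hx => h x (Submodule.mem_sup_right hx))
    refine ⟨k + l, fun r hr y hy => ?_⟩
    obtain ⟨a, ha, b, hb, rfl⟩ := Submodule.mem_sup.1 hy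
    rw [smul_add, hk r (Ideal.pow_le_pow_right (Nat.le_add_right k l) hr) a ha,
      hl r (Ideal.pow_le_pow_right (Nat.le_add_left l k) hr) b hb, add_zero]

theorem powTorsion_quotient_eq_bot [IsNoetherianRing R] :
    powTorsion J (M ⧸ powTorsion J M) = ⊥ := by
  rw [eq_bot_iff]
  intro y hy
  obtain ⟨x, rfl⟩ := Submodule.Quotient.mk_surjective _ y
  obtain ⟨k, hk⟩ := hy
  have hk' : ∀ r ∈ J ^ k, r • x ∈ powTorsion J M := by
    intro r hr
    rw [← Submodule.Quotient.mk_eq_zero]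
    exact hk r hr
  obtain ⟨l, hl⟩ := exists_pow_le_annihilator_of_fg J
    (Submodule.map (LinearMap.toSpanSingleton R M x) (J ^ k))
    ((IsNoetherian.noetherian (J ^ k)).map _) (by
      rintro _ ⟨r, hr, rfl⟩
      exact hk' r hr)
  rw [Submodule.mem_bot, Submodule.Quotient.mk_eq_zero]
  refine ⟨l + k, fun r hr => ?_⟩
  rw [pow_add] at hr
  induction hr using Submodule.mul_induction_on' with
  | mem_mul_mem a ha b hb =>
    rw [mul_smul]
    exact hl a ha _ ⟨b, hb, rfl⟩
  | add a _ b _ ha hb => rw [add_smul, ha, hb, add_zero]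

theorem injective_powTorsion [IsNoetherianRing R] [Module.Injective R M] :
    Module.Injective R (powTorsion J M) := by
  apply Module.Baer.injective
  intro a g
  obtain ⟨k, hk⟩ := exists_pow_le_annihilator_of_fg J (LinearMap.range g)
    (Module.Finite.fg_top.map g |> fun h => by rwa [Submodule.map_top] at h)
    (fun x _ => isPowTorsion_powTorsion J x)
  obtain ⟨c, hc⟩ := Ideal.exists_pow_inf_eq_pow_smul J (M := R) a
  have hker : ∀ x (hx : x ∈ a), x ∈ J ^ (k + c) → g ⟨x, hx⟩ = 0 := by
    intro x hx hxJ
    have h1 : x ∈ J ^ k • a := by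
      have := hc (k + c) (Nat.le_add_left c k)
      have h2 : x ∈ J ^ (k + c) • (⊤ : Submodule R R) ⊓ a := by
        refine ⟨?_, hx⟩
        simpa using hxJ
      rw [this, Nat.add_sub_cancel] at h2
      exact Submodule.smul_mono le_rfl inf_le_right h2
    have h3 : (⟨x, hx⟩ : a) ∈ J ^ k • (⊤ : Submodule R a) := by
      have : x ∈ Submodule.map a.subtype (J ^ k • (⊤ : Submodule R a)) := by
        rw [Submodule.map_smul'', Submodule.map_top, Submodule.range_subtype]
        exact h1
      obtain ⟨y, hy, rfl⟩ := this
      exact hy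
    exact Submodule.smul_induction_on (p := fun y => g y = 0) h3
      (fun r hr n _ => by rw [map_smul]; exact hk r hr _ ⟨n, rfl⟩)
      (fun y z hy hz => by rw [map_add, hy, hz, add_zero])
  let q : a →ₗ[R] R ⧸ J ^ (k + c) := (Submodule.mkQ (J ^ (k + c))).comp a.subtype
  let g' : (a ⧸ LinearMap.ker q) →ₗ[R] M :=
    Submodule.liftQ _ ((powTorsion J M).subtype.comp g) (by
      rintro ⟨x, hx⟩ h
      have : x ∈ J ^ (k + c) := (Submodule.Quotient.mk_eq_zero _).1 h
      rw [LinearMap.mem_ker, LinearMap.comp_apply, hker x hx this, map_zero])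
  let q' : (a ⧸ LinearMap.ker q) →ₗ[R] R ⧸ J ^ (k + c) := Submodule.liftQ _ q le_rfl
  have hq' : Function.Injective q' := by
    rw [← LinearMap.ker_eq_bot]
    exact Submodule.ker_liftQ_eq_bot _ _ _ le_rfl
  obtain ⟨h, hh⟩ := Module.Injective.out q' hq' g'
  refine ⟨LinearMap.codRestrict _ (h.comp (Submodule.mkQ (J ^ (k + c)))) ?_, ?_⟩
  · intro r
    refine ⟨k + c, fun s hs => ?_⟩
    rw [← map_smul, LinearMap.comp_apply]
    have : Submodule.mkQ (J ^ (k + c)) (s • r) = 0 :=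
      (Submodule.Quotient.mk_eq_zero _).2 (Ideal.mul_mem_right _ _ hs)
    rw [this, map_zero]
  · intro x hx
    apply Subtype.ext
    exact hh (Submodule.Quotient.mk ⟨x, hx⟩)

theorem exists_injective_embedding (R : Type) [CommRing R] (M : Type) [AddCommGroup M]
    [Module R M] :
    ∃ (E : Type) (_ : AddCommGroup E) (_ : Module R E) (_ : Module.Injective R E)
      (f : M →ₗ[R] E), Function.Injective f := by
  refine ⟨(CategoryTheory.Injective.under (ModuleCat.of R M) : ModuleCat.{0} R),
    inferInstance, inferInstance, ?_, (CategoryTheory.Injective.ι (ModuleCat.of R M)).hom, ?_⟩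
  · exact @Module.injective_module_of_injective_object _ _ _ _ _
      (inferInstanceAs (CategoryTheory.Injective (Injective.under (ModuleCat.of R M))))
  · exact (ModuleCat.mono_iff_injective _).1 inferInstance

end PowTorsion

section TorsionVanishing

variable {R : Type} [CommRing R] (J : Ideal R) {M N P : Type}
  [AddCommGroup M] [Module R M] [AddCommGroup N] [Module R N] [AddCommGroup P] [Module R P]

theorem Function.Exact.subsingleton_middle {A B C : Type} [AddCommGroup A] [AddCommGroup B]
    [AddCommGroup C] [Module R A] [Module R B] [Module R C] {f : A →ₗ[R] B} {g : B →ₗ[R] C}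
    (h : Function.Exact f g) [Subsingleton A] [Subsingleton C] : Subsingleton B := by
  have : ∀ b : B, b = 0 := by
    intro b
    obtain ⟨a, rfl⟩ := (h b).1 (Subsingleton.elim _ _)
    rw [Subsingleton.elim a 0, map_zero]
  exact ⟨fun a b => by rw [this a, this b]⟩

theorem Function.Exact.injective_of_subsingleton {A B C : Type} [AddCommGroup A] [AddCommGroup B]
    [AddCommGroup C] [Module R A] [Module R B] [Module R C] {f : A →ₗ[R] B} {g : B →ₗ[R] C}
    (h : Function.Exact f g) [Subsingleton A] : Function.Injective g := by
  rw [injective_iff_map_eq_zero]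
  intro b hb
  obtain ⟨a, rfl⟩ := (h b).1 hb
  rw [Subsingleton.elim a 0, map_zero]

theorem Function.Exact.surjective_of_subsingleton {A B C : Type} [AddCommGroup A] [AddCommGroup B]
    [AddCommGroup C] [Module R A] [Module R B] [Module R C] {f : A →ₗ[R] B} {g : B →ₗ[R] C}
    (h : Function.Exact f g) [Subsingleton C] : Function.Surjective f :=
  fun b => (h b).1 (Subsingleton.elim _ _)

namespace LocCoh

variable {f : M →ₗ[R] N} {g : N →ₗ[R] P}

theorem evalOne_surjective_of_isPowTorsion (h : IsPowTorsion J M) :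
    Function.Surjective (evalOne J (M := M)) := by
  intro x
  exact (mem_range_evalOne_iff J x).2 (h x)

theorem map_zero_surjective (hN : IsPowTorsion J N) (hg : Function.Surjective g) :
    Function.Surjective (map J 0 g) := by
  intro b
  obtain ⟨y, hy⟩ := hg (evalOne J b)
  obtain ⟨a, rfl⟩ := evalOne_surjective_of_isPowTorsion J hN y
  refine ⟨a, evalOne_injective J ?_⟩
  rw [evalOne_map, hy]

theorem subsingleton_of_isPowTorsion [IsNoetherianRing R] (i : ℕ) (M : Type) [AddCommGroup M]
    [Module R M] (h : IsPowTorsion J M) : Subsingleton (LocCoh J (i + 1) M) := by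
  induction i generalizing M with
  | zero =>
    obtain ⟨E, _, _, _, f, hf⟩ := exists_injective_embedding R M
    have hf' : ∀ x, f x ∈ powTorsion J E := by
      intro x
      obtain ⟨k, hk⟩ := h x
      exact ⟨k, fun r hr => by rw [← map_smul, hk r hr, map_zero]⟩
    have : Module.Injective R (powTorsion J E) := injective_powTorsion J
    let f' := f.codRestrict _ hf'
    have hf'' : Function.Injective f' := fun a b hab => hf (congrArg Subtype.val hab)
    obtain ⟨δ, h1, h2⟩ := exists_connecting J 0 hf'' f'.exact_map_mkQ_range
      (Submodule.mkQ_surjective _)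
    have := subsingleton_of_injective J 0 (M := powTorsion J E)
    have hs := map_zero_surjective J (isPowTorsion_powTorsion J (M := E))
      (Submodule.mkQ_surjective (LinearMap.range f'))
    refine ⟨fun a b => ?_⟩
    obtain ⟨a, rfl⟩ := h2.surjective_of_subsingleton a
    obtain ⟨b, rfl⟩ := h2.surjective_of_subsingleton b
    obtain ⟨a, rfl⟩ := hs a
    obtain ⟨b, rfl⟩ := hs b
    rw [h1.apply_apply_eq_zero, h1.apply_apply_eq_zero]
  | succ i ih =>
    obtain ⟨E, _, _, _, f, hf⟩ := exists_injective_embedding R M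
    have hf' : ∀ x, f x ∈ powTorsion J E := by
      intro x
      obtain ⟨k, hk⟩ := h x
      exact ⟨k, fun r hr => by rw [← map_smul, hk r hr, map_zero]⟩
    have : Module.Injective R (powTorsion J E) := injective_powTorsion J
    let f' := f.codRestrict _ hf'
    have hf'' : Function.Injective f' := fun a b hab => hf (congrArg Subtype.val hab)
    obtain ⟨δ, h1, h2⟩ := exists_connecting J (i + 1) hf'' f'.exact_map_mkQ_range
      (Submodule.mkQ_surjective _)
    have := subsingleton_of_injective J (i + 1) (M := powTorsion J E)
    have := ih (powTorsion J E ⧸ LinearMap.range f')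
      ((isPowTorsion_powTorsion J (M := E)).of_surjective _ (Submodule.mkQ_surjective _))
    exact h2.subsingleton_middle

/-- Dividing by the torsion submodule does not change local cohomology in positive degree. -/
theorem map_mkQ_powTorsion_bijective [IsNoetherianRing R] (i : ℕ) :
    Function.Bijective (map J (i + 1) (powTorsion J M).mkQ) := by
  have he := LinearMap.exact_subtype_mkQ (powTorsion J M)
  constructor
  · have := subsingleton_of_isPowTorsion J i (powTorsion J M) (isPowTorsion_powTorsion J)
    exact (exact_map J (i + 1) (Submodule.subtype_injective _) he
      (Submodule.mkQ_surjective _)).injective_of_subsingleton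
  · obtain ⟨δ, h1, h2⟩ := exists_connecting J (i + 1) (Submodule.subtype_injective _) he
      (Submodule.mkQ_surjective _)
    have := subsingleton_of_isPowTorsion J (i + 1) (powTorsion J M) (isPowTorsion_powTorsion J)
    exact h1.surjective_of_subsingleton

/-- Local cohomology in positive degree modulo the torsion submodule. -/
noncomputable def quotTorsionEquiv [IsNoetherianRing R] (i : ℕ) (M : Type) [AddCommGroup M]
    [Module R M] : LocCoh J (i + 1) M ≃ₗ[R] LocCoh J (i + 1) (M ⧸ powTorsion J M) :=
  LinearEquiv.ofBijective _ (map_mkQ_powTorsion_bijective J i)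

end LocCoh

end TorsionVanishing

section Multiplication

variable {R : Type} [CommRing R] (J : Ideal R) (i : ℕ) {N : Type} [AddCommGroup N] [Module R N]

theorem exact_lsmul_mkQ (x : R) :
    Function.Exact (LinearMap.lsmul R N x) (x • (⊤ : Submodule R N)).mkQ := by
  intro n
  simp [Submodule.mem_smul_pointwise_iff_exists]

namespace LocCoh

theorem subsingleton_of_subsingleton [Subsingleton N] : Subsingleton (LocCoh J i N) := by
  refine ⟨fun a b => ?_⟩
  have h : ∀ a : LocCoh J i N, a = 0 := fun a => by
    have h1 := map_lsmul J i 1 a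
    have h2 := map_lsmul J i 0 a
    rw [one_smul] at h1
    rw [zero_smul] at h2
    rw [← h1, ← h2]
    congr 2
    ext n
    exact Subsingleton.elim _ _
  rw [h a, h b]

theorem exact_smul_map {x : R} (hx : IsSMulRegular N x) (b : LocCoh J i N) :
    map J i (x • (⊤ : Submodule R N)).mkQ b = 0 ↔ ∃ a : LocCoh J i N, x • a = b := by
  refine (exact_map J i (f := LinearMap.lsmul R N x) hx (exact_lsmul_mkQ x)
    (Submodule.mkQ_surjective _) b).trans ?_
  simp [map_lsmul]

theorem exists_connecting_smul {x : R} (hx : IsSMulRegular N x) :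
    ∃ δ : LocCoh J i (N ⧸ (x • (⊤ : Submodule R N))) →ₗ[R] LocCoh J (i + 1) N,
      Function.Exact (map J i (x • (⊤ : Submodule R N)).mkQ) δ ∧
        ∀ a, x • a = 0 ↔ ∃ c, δ c = a := by
  obtain ⟨δ, h1, h2⟩ := exists_connecting J i (f := LinearMap.lsmul R N x) hx (exact_lsmul_mkQ x)
    (Submodule.mkQ_surjective _)
  refine ⟨δ, h1, fun a => ?_⟩
  rw [← map_lsmul]
  exact h2 a

theorem smul_surjective_of_subsingleton {x : R} (hx : IsSMulRegular N x)
    [Subsingleton (LocCoh J i (N ⧸ (x • (⊤ : Submodule R N))))] (b : LocCoh J i N) :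
    ∃ a : LocCoh J i N, x • a = b :=
  (exact_smul_map J i hx b).1 (Subsingleton.elim _ _)

theorem subsingleton_of_smul_injective {x : R} (hxJ : x ∈ J)
    (h : ∀ a : LocCoh J i N, x • a = 0 → a = 0) : Subsingleton (LocCoh J i N) := by
  have h0 : ∀ a : LocCoh J i N, a = 0 := by
    intro a
    obtain ⟨k, hk⟩ := exists_pow_smul_eq_zero J i a
    have h1 : ∀ k : ℕ, x ^ k • a = 0 → a = 0 := by
      intro k
      induction k with
      | zero => simp
      | succ k ih =>
        intro hk
        rw [pow_succ', mul_smul] at hk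
        exact ih (h _ hk)
    exact h1 k (hk _ (Ideal.pow_mem_pow hxJ k))
  exact ⟨fun a b => by rw [h0 a, h0 b]⟩

theorem supportDim_quotTorsion_lt {d : WithBot ℕ∞}
    (hN : Module.supportDim R N < d) :
    Module.supportDim R (N ⧸ powTorsion J N) < d :=
  (Module.supportDim_le_of_surjective _ (Submodule.mkQ_surjective _)).trans_lt hN

theorem subsingleton_of_supportDim_lt_zero (hN : Module.supportDim R N < ((0 : ℕ) : WithBot ℕ∞)) :
    Subsingleton N := by
  by_contra hc
  rw [not_subsingleton_iff_nontrivial] at hc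
  obtain ⟨n, hn⟩ := WithBot.ne_bot_iff_exists.1 (Module.supportDim_ne_bot_of_nontrivial R N)
  rw [← hn] at hN
  have : n < 0 := by exact_mod_cast hN
  exact not_lt_bot this

end LocCoh

end Multiplication

section LocalVanishing

variable {R : Type} [CommRing R] [IsNoetherianRing R] [IsLocalRing R]

theorem exists_isSMulRegular_of_powTorsion_eq_bot (N : Type) [AddCommGroup N] [Module R N]
    [Module.Finite R N] (h : powTorsion (maximalIdeal R) N = ⊥) :
    ∃ x ∈ maximalIdeal R, IsSMulRegular N x := by
  have hs : Subsingleton ((R ⧸ maximalIdeal R) →ₗ[R] N) := by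
    have h0 : ∀ f : (R ⧸ maximalIdeal R) →ₗ[R] N, f = 0 := by
      intro f
      have h1 : f 1 ∈ powTorsion (maximalIdeal R) N := by
        refine ⟨1, fun r hr => ?_⟩
        rw [pow_one] at hr
        rw [← map_smul]
        have : r • (1 : R ⧸ maximalIdeal R) = 0 := by
          rw [Algebra.smul_def, mul_one]
          exact Ideal.Quotient.eq_zero_iff_mem.2 hr
        rw [this, map_zero]
      rw [h, Submodule.mem_bot] at h1
      ext
      simpa using h1
    exact ⟨fun f g => by rw [h0 f, h0 g]⟩
  obtain ⟨x, hx, hx'⟩ := IsSMulRegular.subsingleton_linearMap_iff.1 hs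
  rw [Ideal.annihilator_quotient] at hx
  exact ⟨x, hx, hx'⟩

namespace LocCoh

theorem withBot_lt_of_add_one_lt {a : WithBot ℕ∞} {d : ℕ} (h : a + 1 < ((d + 1 : ℕ) : WithBot ℕ∞)) :
    a < (d : WithBot ℕ∞) := by
  by_contra hc
  rw [not_lt] at hc
  have := add_le_add_left hc 1
  push_cast at h
  exact absurd h (not_lt.2 this)

theorem supportDim_quotient_lt {N : Type} [AddCommGroup N] [Module R N] [Module.Finite R N] {x : R}
    {d : ℕ} (hxm : x ∈ maximalIdeal R) (hx : IsSMulRegular N x)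
    (hN : Module.supportDim R N < ((d + 1 : ℕ) : WithBot ℕ∞)) :
    Module.supportDim R (N ⧸ (x • (⊤ : Submodule R N))) < (d : WithBot ℕ∞) := by
  apply withBot_lt_of_add_one_lt
  have := Module.supportDim_quotSMulTop_succ_eq_supportDim hx hxm
  rw [← this] at hN
  exact hN

/-- Local cohomology vanishes above the dimension. -/
theorem subsingleton_of_supportDim_lt (d : ℕ) (N : Type) [AddCommGroup N] [Module R N]
    [Module.Finite R N] (hN : Module.supportDim R N < (d : WithBot ℕ∞)) (i : ℕ) (hi : d ≤ i) :
    Subsingleton (LocCoh (maximalIdeal R) i N) := by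
  induction d generalizing N i with
  | zero =>
    have := subsingleton_of_supportDim_lt_zero hN
    exact subsingleton_of_subsingleton _ i
  | succ d ih =>
    obtain ⟨i, rfl⟩ : ∃ k, i = k + 1 := ⟨i - 1, by omega⟩
    set N' := N ⧸ powTorsion (maximalIdeal R) N
    obtain ⟨x, hxm, hx⟩ := exists_isSMulRegular_of_powTorsion_eq_bot N'
      (powTorsion_quotient_eq_bot (maximalIdeal R))
    have hN' := supportDim_quotTorsion_lt (maximalIdeal R) hN
    have hq := supportDim_quotient_lt hxm hx hN'
    have := ih _ hq i (by omega)
    obtain ⟨δ, -, h2⟩ := exists_connecting_smul (maximalIdeal R) i hx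
    have : Subsingleton (LocCoh (maximalIdeal R) (i + 1) N') := by
      refine subsingleton_of_smul_injective _ _ hxm fun a ha => ?_
      obtain ⟨c, rfl⟩ := (h2 a).1 ha
      rw [Subsingleton.elim c 0, map_zero]
    exact (quotTorsionEquiv (maximalIdeal R) i N).toEquiv.subsingleton

/-- Top local cohomology in positive degree is coregular for some element. -/
theorem exists_smul_surjective (j : ℕ) (N : Type) [AddCommGroup N] [Module R N]
    [Module.Finite R N] (hN : Module.supportDim R N < ((j + 2 : ℕ) : WithBot ℕ∞)) :
    ∃ y ∈ maximalIdeal R, ∀ b : LocCoh (maximalIdeal R) (j + 1) N,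
      ∃ a : LocCoh (maximalIdeal R) (j + 1) N, y • a = b := by
  set N' := N ⧸ powTorsion (maximalIdeal R) N
  obtain ⟨y, hym, hy⟩ := exists_isSMulRegular_of_powTorsion_eq_bot N'
    (powTorsion_quotient_eq_bot (maximalIdeal R))
  have hq := supportDim_quotient_lt hym hy (supportDim_quotTorsion_lt (maximalIdeal R) hN)
  have := subsingleton_of_supportDim_lt _ _ hq _ le_rfl
  refine ⟨y, hym, fun b => ?_⟩
  let e := quotTorsionEquiv (maximalIdeal R) j N
  obtain ⟨a, ha⟩ := smul_surjective_of_subsingleton (maximalIdeal R) (j + 1) hy (e b)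
  exact ⟨e.symm a, e.injective (by rw [map_smul, e.apply_symm_apply, ha])⟩

/-- Top local cohomology in degree at least two has a coregular sequence of length two. -/
theorem exists_smul_surjective_pair (j : ℕ) (N : Type) [AddCommGroup N] [Module R N]
    [Module.Finite R N] (hN : Module.supportDim R N < ((j + 3 : ℕ) : WithBot ℕ∞)) :
    ∃ y ∈ maximalIdeal R, ∃ z ∈ maximalIdeal R,
      (∀ b : LocCoh (maximalIdeal R) (j + 2) N,
        ∃ a : LocCoh (maximalIdeal R) (j + 2) N, y • a = b) ∧
      ∀ b : LocCoh (maximalIdeal R) (j + 2) N, y • b = 0 →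
        ∃ b' : LocCoh (maximalIdeal R) (j + 2) N, y • b' = 0 ∧ z • b' = b := by
  set N' := N ⧸ powTorsion (maximalIdeal R) N
  obtain ⟨y, hym, hy⟩ := exists_isSMulRegular_of_powTorsion_eq_bot N'
    (powTorsion_quotient_eq_bot (maximalIdeal R))
  have hq := supportDim_quotient_lt hym hy (supportDim_quotTorsion_lt (maximalIdeal R) hN)
  have := subsingleton_of_supportDim_lt _ _ hq _ le_rfl
  obtain ⟨z, hzm, hz⟩ := exists_smul_surjective j _ hq
  obtain ⟨δ, -, h2⟩ := exists_connecting_smul (maximalIdeal R) (j + 1) hy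
  let e := quotTorsionEquiv (maximalIdeal R) (j + 1) N
  refine ⟨y, hym, z, hzm, fun b => ?_, fun b hb => ?_⟩
  · obtain ⟨a, ha⟩ := smul_surjective_of_subsingleton (maximalIdeal R) (j + 2) hy (e b)
    exact ⟨e.symm a, e.injective (by rw [map_smul, e.apply_symm_apply, ha])⟩
  · obtain ⟨c, hc⟩ := (h2 (e b)).1 (by rw [← map_smul, hb, map_zero])
    obtain ⟨c', rfl⟩ := hz c
    have h3 := (h2 (δ c')).2 ⟨c', rfl⟩
    refine ⟨e.symm (δ c'), e.injective ?_, e.injective ?_⟩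
    · rw [map_smul, e.apply_symm_apply, h3, map_zero]
    · rw [map_smul, e.apply_symm_apply, ← hc, map_smul]

end LocCoh

end LocalVanishing

section FlatBaseChange

theorem mem_range_iff_of_subsingleton {R S : Type} [CommRing R] [CommRing S] {A B A' B' : Type}
    [AddCommGroup A] [AddCommGroup B]
    [AddCommGroup A'] [AddCommGroup B'] [Module S A] [Module S B] [Module R A'] [Module R B']
    (φ : A →ₗ[S] B) (ψ : A' →ₗ[R] B') (hA : Subsingleton A) (hA' : Subsingleton A')
    (e : B ≃+ B') (x : B) : x ∈ LinearMap.range φ ↔ e x ∈ LinearMap.range ψ := by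
  constructor
  · rintro ⟨y, rfl⟩
    exact ⟨0, by rw [hA.elim y 0, map_zero, map_zero, map_zero]⟩
  · rintro ⟨y, hy⟩
    rw [hA'.elim y 0, map_zero] at hy
    exact ⟨0, by rw [e.map_eq_zero_iff.1 hy.symm, map_zero]⟩

variable (R : Type) {S : Type} [CommRing R] [CommRing S] [Algebra R S]

theorem Module.Injective.restrictScalars_of_flat [Module.Flat R S] (I : Type) [AddCommGroup I]
    [Module R I] [Module S I] [IsScalarTower R S I] [Module.Injective S I] :
    Module.Injective R I := by
  refine ⟨fun X Y _ _ _ _ f hf g => ?_⟩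
  have hf' : Function.Injective (f.baseChange S) :=
    Module.Flat.lTensor_preserves_injective_linearMap f hf
  obtain ⟨h, hh⟩ := Module.Injective.out (R := S) (f.baseChange S) hf'
    (TensorProduct.AlgebraTensorModule.lift
      ((LinearMap.lsmul S (X →ₗ[R] I)).flip g))
  refine ⟨(h.restrictScalars R).comp (TensorProduct.mk R S Y 1), fun x => ?_⟩
  have := hh (1 ⊗ₜ x)
  simpa using this

theorem exists_addEquiv_of_surjective {A B C : Type} [AddCommGroup A] [AddCommGroup B]
    [AddCommGroup C] (f : A →+ B) (g : A →+ C) (hf : Function.Surjective f)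
    (hg : Function.Surjective g) (h : ∀ a, f a = 0 ↔ g a = 0) :
    ∃ e : B ≃+ C, ∀ a, e (f a) = g a := by
  have hk : f.ker = g.ker := by
    ext a
    exact h a
  refine ⟨(QuotientAddGroup.quotientKerEquivOfSurjective f hf).symm.trans
    ((QuotientAddGroup.quotientAddEquivOfEq hk).trans
      (QuotientAddGroup.quotientKerEquivOfSurjective g hg)), fun a => ?_⟩
  have : (QuotientAddGroup.quotientKerEquivOfSurjective f hf).symm (f a) = (a : A ⧸ f.ker) := by
    rw [AddEquiv.symm_apply_eq]
    rfl
  simp only [AddEquiv.trans_apply, this]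
  rfl

variable {R} (J : Ideal R)

theorem forall_mem_map_smul_eq_zero_iff {N : Type} [AddCommGroup N]
    [Module R N] [Module S N] [IsScalarTower R S N] (x : N) :
    (∀ s ∈ J.map (algebraMap R S), s • x = 0) ↔ ∀ r ∈ J, r • x = 0 := by
  constructor
  · intro h r hr
    rw [← algebraMap_smul S]
    exact h _ (Ideal.mem_map_of_mem _ hr)
  · intro h s hs
    have : J.map (algebraMap R S) ≤ LinearMap.ker (LinearMap.toSpanSingleton S N x) := by
      rw [Ideal.map_le_iff_le_comap]
      intro r hr
      simpa using h r hr
    exact this hs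

namespace LocCoh

theorem exists_baseChange_zero (N : Type) [AddCommGroup N]
    [Module R N] [Module S N] [IsScalarTower R S N] :
    ∃ e : LocCoh (J.map (algebraMap R S)) 0 N ≃+ LocCoh J 0 N,
      ∀ x, evalOne J (e x) = evalOne (J.map (algebraMap R S)) x := by
  have hr : ∀ x : N, x ∈ LinearMap.range (evalOne (J.map (algebraMap R S)) (M := N)) ↔
      x ∈ LinearMap.range (evalOne J (M := N)) := by
    intro x
    rw [mem_range_evalOne_iff, mem_range_evalOne_iff]
    refine exists_congr fun k => ?_
    rw [← Ideal.map_pow, forall_mem_map_smul_eq_zero_iff]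
  have h1 : ∀ x : LocCoh (J.map (algebraMap R S)) 0 N, ∃ y : LocCoh J 0 N,
      evalOne J y = evalOne (J.map (algebraMap R S)) x := fun x => (hr _).1 ⟨x, rfl⟩
  choose φ hφ using h1
  let ψ : LocCoh (J.map (algebraMap R S)) 0 N →+ LocCoh J 0 N :=
    { toFun := φ
      map_zero' := evalOne_injective J (by rw [hφ, map_zero, map_zero])
      map_add' := fun a b => evalOne_injective J (by rw [hφ, map_add, map_add, hφ, hφ]) }
  have hb : Function.Bijective ψ := by
    constructor
    · intro a b hab
      refine evalOne_injective (J.map (algebraMap R S)) ?_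
      rw [← hφ, ← hφ]
      exact congrArg _ hab
    · intro y
      obtain ⟨x, hx⟩ := (hr _).2 ⟨y, rfl⟩
      exact ⟨x, evalOne_injective J ((hφ x).trans hx)⟩
  exact ⟨AddEquiv.ofBijective ψ hb, hφ⟩

theorem exists_baseChange_step (i : ℕ) {N I C : Type} [AddCommGroup N] [AddCommGroup I]
    [AddCommGroup C] [Module R N] [Module S N] [IsScalarTower R S N]
    [Module R I] [Module S I] [IsScalarTower R S I]
    [Module R C] [Module S C] [IsScalarTower R S C]
    {f : N →ₗ[S] I} {g : I →ₗ[S] C} (hf : Function.Injective f) (hfg : Function.Exact f g)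
    (hg : Function.Surjective g) [Module.Injective S I] [Module.Injective R I]
    (e : LocCoh (J.map (algebraMap R S)) i C ≃+ LocCoh J i C)
    (he : ∀ (r : R) x, e (algebraMap R S r • x) = r • e x)
    (hr : ∀ x, x ∈ LinearMap.range (map (J.map (algebraMap R S)) i g) ↔
      e x ∈ LinearMap.range (map J i (g.restrictScalars R))) :
    ∃ e : LocCoh (J.map (algebraMap R S)) (i + 1) N ≃+ LocCoh J (i + 1) N,
      ∀ (r : R) x, e (algebraMap R S r • x) = r • e x := by
  obtain ⟨δ, h1, h2⟩ := exists_connecting (J.map (algebraMap R S)) i hf hfg hg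
  obtain ⟨δ', h1', h2'⟩ := exists_connecting J i (f := f.restrictScalars R)
    (g := g.restrictScalars R) hf hfg hg
  have := subsingleton_of_injective (J.map (algebraMap R S)) i (M := I)
  have := subsingleton_of_injective J i (M := I)
  have hδ := h2.surjective_of_subsingleton
  have hδ' := h2'.surjective_of_subsingleton
  obtain ⟨e', he'⟩ := exists_addEquiv_of_surjective δ.toAddMonoidHom
    (δ'.toAddMonoidHom.comp e.toAddMonoidHom) hδ (hδ'.comp e.surjective) (fun a =>
      ((h1 a).trans (hr a)).trans (h1' (e a)).symm)
  refine ⟨e', fun r x => ?_⟩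
  obtain ⟨c, rfl⟩ := hδ x
  have h3 : ∀ c, e' (δ c) = δ' (e c) := he'
  rw [← map_smul, h3, h3, he, map_smul]

/-- Local cohomology with respect to an extended ideal along a flat ring map is computed over the
base ring. -/
theorem exists_baseChange [Module.Flat R S] (i : ℕ) (N : Type) [AddCommGroup N]
    [Module R N] [Module S N] [IsScalarTower R S N] :
    ∃ e : LocCoh (J.map (algebraMap R S)) i N ≃+ LocCoh J i N,
      ∀ (r : R) x, e (algebraMap R S r • x) = r • e x := by
  have h0 : ∀ (C : Type) [AddCommGroup C] [Module R C] [Module S C] [IsScalarTower R S C]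
      (e : LocCoh (J.map (algebraMap R S)) 0 C ≃+ LocCoh J 0 C)
      (_ : ∀ x, evalOne J (e x) = evalOne (J.map (algebraMap R S)) x),
      ∀ (r : R) x, e (algebraMap R S r • x) = r • e x := by
    intro C _ _ _ _ e he r x
    refine evalOne_injective J ?_
    rw [he, map_smul, map_smul, he, algebraMap_smul]
  induction i generalizing N with
  | zero =>
    obtain ⟨e, he⟩ := exists_baseChange_zero (S := S) J N
    exact ⟨e, h0 N e he⟩
  | succ i ih =>
    obtain ⟨I, _, _, _, f, hf⟩ := exists_injective_embedding S N
    let _ : Module R I := Module.compHom I (algebraMap R S)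
    have : IsScalarTower R S I := IsScalarTower.of_algebraMap_smul fun _ _ => rfl
    have := Module.Injective.restrictScalars_of_flat R (S := S) I
    rcases i with _ | i
    · obtain ⟨e, he⟩ := exists_baseChange_zero (S := S) J (I ⧸ LinearMap.range f)
      obtain ⟨e', he'⟩ := exists_baseChange_zero (S := S) J I
      refine exists_baseChange_step J 0 hf f.exact_map_mkQ_range (Submodule.mkQ_surjective _) e
        (h0 _ e he) fun x => ?_
      constructor
      · rintro ⟨y, rfl⟩
        refine ⟨e' y, evalOne_injective J ?_⟩
        rw [evalOne_map, he, he', evalOne_map]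
        rfl
      · rintro ⟨y, hy⟩
        obtain ⟨y, rfl⟩ := e'.surjective y
        refine ⟨y, evalOne_injective (J.map (algebraMap R S)) ?_⟩
        rw [evalOne_map, ← he, ← hy, evalOne_map, he']
        rfl
    · obtain ⟨e, he⟩ := ih (I ⧸ LinearMap.range f)
      refine exists_baseChange_step J (i + 1) hf f.exact_map_mkQ_range (Submodule.mkQ_surjective _)
        e he fun x => ?_
      have hS := subsingleton_of_injective (J.map (algebraMap R S)) i (M := I)
      have hR := subsingleton_of_injective J i (M := I)
      exact mem_range_iff_of_subsingleton _ _ hS hR e x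

end LocCoh

end FlatBaseChange

section CompletionQuotient

theorem IsPrecomplete.of_pow_smul_eq_bot {R : Type} [CommRing R] {I : Ideal R} {M : Type}
    [AddCommGroup M] [Module R M] {k : ℕ} (hk : I ^ k • (⊤ : Submodule R M) = ⊥) :
    IsPrecomplete I M := by
  refine ⟨fun f hf => ⟨f k, fun n => ?_⟩⟩
  rcases le_total n k with h | h
  · exact hf h
  · have h1 := hf h
    rw [hk, SModEq.bot] at h1
    rw [h1]

variable {R : Type} [CommRing R] (I : Ideal R) {M N P : Type}
  [AddCommGroup M] [Module R M] [AddCommGroup N] [Module R N] [AddCommGroup P] [Module R P]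

variable (M) in
/-- The cokernel of the map from a module to its adic completion. -/
abbrev CompletionQuotient : Type := AdicCompletion I M ⧸ LinearMap.range (AdicCompletion.of I M)

namespace CompletionQuotient

/-- Functoriality of the cokernel of the map to the adic completion. -/
noncomputable def map (f : M →ₗ[R] N) : CompletionQuotient I M →ₗ[R] CompletionQuotient I N :=
  Submodule.mapQ _ _ ((AdicCompletion.map I f).restrictScalars R) (by
    rintro _ ⟨x, rfl⟩
    exact ⟨f x, (AdicCompletion.map_of I f x).symm⟩)

theorem map_mk (f : M →ₗ[R] N) (y : AdicCompletion I M) :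
    map I f (Submodule.Quotient.mk y) = Submodule.Quotient.mk (AdicCompletion.map I f y) := rfl

theorem mk_eq_zero (y : AdicCompletion I M) :
    (Submodule.Quotient.mk y : CompletionQuotient I M) = 0 ↔ ∃ x, AdicCompletion.of I M x = y :=
  Submodule.Quotient.mk_eq_zero _

theorem map_lsmul (r : R) :
    map I (LinearMap.lsmul R M r) = LinearMap.lsmul R (CompletionQuotient I M) r := by
  ext y
  rfl

variable {f : M →ₗ[R] N} {g : N →ₗ[R] P}

theorem map_surjective (hg : Function.Surjective g) : Function.Surjective (map I g) := by
  intro y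
  obtain ⟨y, rfl⟩ := Submodule.Quotient.mk_surjective _ y
  obtain ⟨x, rfl⟩ := AdicCompletion.map_surjective I hg y
  exact ⟨Submodule.Quotient.mk x, rfl⟩

theorem map_exact [IsNoetherianRing R] [Module.Finite R N] (hf : Function.Injective f)
    (hfg : Function.Exact f g) (hg : Function.Surjective g) :
    Function.Exact (map I f) (map I g) := by
  have he := AdicCompletion.map_exact (I := I) hf hfg hg
  intro y
  constructor
  · intro hy
    obtain ⟨y, rfl⟩ := Submodule.Quotient.mk_surjective _ y
    rw [map_mk, mk_eq_zero] at hy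
    obtain ⟨p, hp⟩ := hy
    obtain ⟨n, rfl⟩ := hg p
    obtain ⟨z, hz⟩ := (he (y - AdicCompletion.of I N n)).1 (by
      rw [map_sub, AdicCompletion.map_of, hp, sub_self])
    refine ⟨Submodule.Quotient.mk z, ?_⟩
    rw [map_mk, hz, Submodule.Quotient.mk_sub, sub_eq_self, mk_eq_zero]
    exact ⟨n, rfl⟩
  · rintro ⟨x, rfl⟩
    obtain ⟨x, rfl⟩ := Submodule.Quotient.mk_surjective _ x
    rw [map_mk, map_mk, he.apply_apply_eq_zero]
    rfl

theorem map_injective [IsNoetherianRing R] [Module.Finite R N] [IsHausdorff I P]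
    (hf : Function.Injective f) (hfg : Function.Exact f g) :
    Function.Injective (map I f) := by
  rw [injective_iff_map_eq_zero]
  intro y hy
  obtain ⟨y, rfl⟩ := Submodule.Quotient.mk_surjective _ y
  rw [map_mk, mk_eq_zero] at hy
  obtain ⟨n, hn⟩ := hy
  have h1 : AdicCompletion.of I P (g n) = 0 := by
    rw [← AdicCompletion.map_of, hn, AdicCompletion.map_comp_apply,
      hfg.linearMap_comp_eq_zero, AdicCompletion.map_zero]
    rfl
  obtain ⟨m, rfl⟩ := (hfg n).1 (AdicCompletion.of_injective I P (h1.trans (map_zero _).symm))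
  rw [mk_eq_zero]
  refine ⟨m, AdicCompletion.map_injective I hf ?_⟩
  rw [AdicCompletion.map_of, hn]

theorem subsingleton_of_isPrecomplete [IsPrecomplete I M] :
    Subsingleton (CompletionQuotient I M) := by
  rw [Submodule.Quotient.subsingleton_iff, LinearMap.range_eq_top]
  exact AdicCompletion.of_surjective I M

theorem subsingleton_powTorsion [IsNoetherianRing R] [Module.Finite R M] :
    Subsingleton (CompletionQuotient I (powTorsion I M)) := by
  obtain ⟨k, hk⟩ := exists_pow_le_annihilator_of_fg I (⊤ : Submodule R (powTorsion I M))
    (Module.Finite.fg_top) (fun x _ => isPowTorsion_powTorsion I x)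
  have : IsPrecomplete I (powTorsion I M) := by
    refine IsPrecomplete.of_pow_smul_eq_bot (k := k) ?_
    rw [eq_bot_iff, Submodule.smul_le]
    exact fun r hr x hx => (Submodule.mem_bot R).2 (hk r hr x hx)
  exact subsingleton_of_isPrecomplete I (M := powTorsion I M)

end CompletionQuotient

namespace LocCoh

theorem subsingleton_of_linearEquiv (i : ℕ) (e : M ≃ₗ[R] N) [Subsingleton (LocCoh I i N)] :
    Subsingleton (LocCoh I i M) := by
  refine Function.Injective.subsingleton (f := map I i (e : M →ₗ[R] N)) fun a b hab => ?_
  have := congrArg (map I i (e.symm : N →ₗ[R] M)) hab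
  rwa [← map_comp_apply, ← map_comp_apply, LinearEquiv.symm_comp, map_id_apply,
    map_id_apply] at this

theorem map_zero_injective {f : M →ₗ[R] N} (hf : Function.Injective f) :
    Function.Injective (map I 0 f) := by
  intro a b hab
  have := congrArg (evalOne I) hab
  rw [evalOne_map, evalOne_map] at this
  exact evalOne_injective I (hf this)

end LocCoh

end CompletionQuotient

section CompletionLocalCohomology

variable {R : Type} [CommRing R] [IsNoetherianRing R] [IsLocalRing R]

namespace LocCoh

theorem subsingleton_completionQuotient (d : ℕ) (M : Type) [AddCommGroup M] [Module R M]
    [Module.Finite R M] (hM : Module.supportDim R M < (d : WithBot ℕ∞)) (i : ℕ) :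
    Subsingleton (LocCoh (maximalIdeal R) i (CompletionQuotient (maximalIdeal R) M)) := by
  induction d generalizing M i with
  | zero =>
    have := subsingleton_of_supportDim_lt_zero hM
    have := CompletionQuotient.subsingleton_of_isPrecomplete (maximalIdeal R) (M := M)
    exact subsingleton_of_subsingleton _ i
  | succ d ih =>
    set M' := M ⧸ powTorsion (maximalIdeal R) M
    have h1 : Function.Bijective
        (CompletionQuotient.map (maximalIdeal R) (powTorsion (maximalIdeal R) M).mkQ) := by
      have := CompletionQuotient.subsingleton_powTorsion (maximalIdeal R) (M := M)
      exact ⟨(CompletionQuotient.map_exact (maximalIdeal R) (Submodule.injective_subtype _)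
        (LinearMap.exact_subtype_mkQ _) (Submodule.mkQ_surjective _)).injective_of_subsingleton,
        CompletionQuotient.map_surjective _ (Submodule.mkQ_surjective _)⟩
    have : Subsingleton (LocCoh (maximalIdeal R) i (CompletionQuotient (maximalIdeal R) M')) := by
      obtain ⟨x, hxm, hx⟩ := exists_isSMulRegular_of_powTorsion_eq_bot M'
        (powTorsion_quotient_eq_bot (maximalIdeal R))
      have hq := supportDim_quotient_lt hxm hx (supportDim_quotTorsion_lt (maximalIdeal R) hM)
      have hxC : Function.Injective
          (LinearMap.lsmul R (CompletionQuotient (maximalIdeal R) M') x) := by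
        rw [← CompletionQuotient.map_lsmul]
        exact CompletionQuotient.map_injective (maximalIdeal R) hx (exact_lsmul_mkQ x)
      refine subsingleton_of_smul_injective _ i hxm fun a ha => ?_
      rw [← map_lsmul] at ha
      rcases i with _ | i
      · exact map_zero_injective _ hxC (ha.trans (map_zero _).symm)
      · have hE := CompletionQuotient.map_exact (maximalIdeal R)
          (f := LinearMap.lsmul R M' x) hx (exact_lsmul_mkQ x) (Submodule.mkQ_surjective _)
        rw [CompletionQuotient.map_lsmul] at hE
        obtain ⟨δ, -, h2⟩ := exists_connecting (maximalIdeal R) i hxC hE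
          (CompletionQuotient.map_surjective _ (Submodule.mkQ_surjective _))
        have := ih _ hq i
        exact h2.injective_of_subsingleton (ha.trans (map_zero _).symm)
    exact subsingleton_of_linearEquiv _ i (LinearEquiv.ofBijective _ h1)

/-- Completion does not change local cohomology in positive degree. -/
theorem map_of_bijective {d : ℕ} (M : Type) [AddCommGroup M] [Module R M]
    [Module.Finite R M] (hM : Module.supportDim R M < (d : WithBot ℕ∞)) (i : ℕ) :
    Function.Bijective (map (maximalIdeal R) (i + 1) (AdicCompletion.of (maximalIdeal R) M)) := by
  have hf := AdicCompletion.of_injective (maximalIdeal R) M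
  have he := LinearMap.exact_map_mkQ_range (AdicCompletion.of (maximalIdeal R) M)
  obtain ⟨δ, -, h2⟩ := exists_connecting (maximalIdeal R) i hf he (Submodule.mkQ_surjective _)
  have := subsingleton_completionQuotient d M hM
  exact ⟨h2.injective_of_subsingleton,
    (exact_map (maximalIdeal R) (i + 1) hf he
      (Submodule.mkQ_surjective _)).surjective_of_subsingleton⟩

/-- Local cohomology of the completion over the completed ring agrees with local cohomology. -/
theorem exists_completion_equiv {d : ℕ} (M : Type) [AddCommGroup M] [Module R M]
    [Module.Finite R M] (hM : Module.supportDim R M < (d : WithBot ℕ∞)) (i : ℕ) :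
    ∃ e : LocCoh ((maximalIdeal R).map (algebraMap R (AdicCompletion (maximalIdeal R) R))) (i + 1)
        (AdicCompletion (maximalIdeal R) M) ≃+ LocCoh (maximalIdeal R) (i + 1) M,
      ∀ (r : R) x, e (algebraMap R (AdicCompletion (maximalIdeal R) R) r • x) = r • e x := by
  obtain ⟨e, he⟩ := exists_baseChange (S := AdicCompletion (maximalIdeal R) R) (maximalIdeal R)
    (i + 1) (AdicCompletion (maximalIdeal R) M)
  let e' := LinearEquiv.ofBijective _ (map_of_bijective M hM i)
  refine ⟨e.trans e'.symm.toAddEquiv, fun r x => ?_⟩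
  have : e'.symm (e (algebraMap R (AdicCompletion (maximalIdeal R) R) r • x)) =
    r • e'.symm (e x) := by rw [he, map_smul]
  exact this

end LocCoh

end CompletionLocalCohomology

section Duality

variable {S : Type} [CommRing S] {V W E : Type} [AddCommGroup V] [Module S V]
  [AddCommGroup W] [Module S W] [AddCommGroup E] [Module S E]

/-- Every nonzero element is detected by a homomorphism into an injective module containing the
residue field. -/
theorem exists_linearMap_apply_ne_zero [IsLocalRing S] [Module.Injective S E]
    (f : (S ⧸ maximalIdeal S) →ₗ[S] E) (hf : Function.Injective f) {w : W} (hw : w ≠ 0) :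
    ∃ h : W →ₗ[S] E, h w ≠ 0 := by
  let t := LinearMap.toSpanSingleton S W w
  have ht : LinearMap.ker t ≤ LinearMap.ker (LinearMap.toSpanSingleton S E (f 1)) := by
    intro s hs
    have hsm : s ∈ maximalIdeal S := by
      rw [mem_maximalIdeal, mem_nonunits_iff]
      intro hu
      have : s • w = 0 := hs
      exact hw ((hu.smul_eq_zero).1 this)
    rw [LinearMap.mem_ker, LinearMap.toSpanSingleton_apply, ← map_smul, Algebra.smul_def, mul_one]
    exact (congrArg f (Ideal.Quotient.eq_zero_iff_mem.2 hsm)).trans (map_zero f)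
  obtain ⟨h, hh⟩ := Module.Injective.out (R := S) ((LinearMap.ker t).liftQ t le_rfl)
    (LinearMap.ker_eq_bot.1 (Submodule.ker_liftQ_eq_bot _ _ _ le_rfl))
    ((LinearMap.ker t).liftQ _ ht)
  refine ⟨h, ?_⟩
  have h1 := hh (Submodule.Quotient.mk 1)
  simp only [Submodule.liftQ_apply, t, LinearMap.toSpanSingleton_apply, one_smul] at h1
  rw [h1]
  intro h0
  exact one_ne_zero (α := S ⧸ maximalIdeal S) (hf (h0.trans (map_zero f).symm))

/-- A module cogenerates if homomorphisms into it separate points of every module. -/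
def IsCogenerating (S : Type) [CommRing S] (E : Type) [AddCommGroup E] [Module S E] : Prop :=
  ∀ (W : Type) [AddCommGroup W] [Module S W] (w : W), (∀ h : W →ₗ[S] E, h w = 0) → w = 0

theorem IsCogenerating.isSMulRegular (hE : IsCogenerating S E) {z : S}
    (h : ∀ k : W →ₗ[S] E, ∃ l : W →ₗ[S] E, z • l = k) : IsSMulRegular W z := by
  rw [isSMulRegular_iff_right_eq_zero_of_smul]
  intro w hw
  refine hE W w fun k => ?_
  obtain ⟨l, rfl⟩ := h k
  rw [LinearMap.smul_apply, ← map_smul, hw, map_zero]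

theorem exists_smul_eq_of_isSMulRegular [Module.Injective S E] {z : S} (hz : IsSMulRegular W z)
    (k : W →ₗ[S] E) : ∃ l : W →ₗ[S] E, z • l = k := by
  obtain ⟨l, hl⟩ := Module.Injective.out (R := S) (LinearMap.lsmul S W z) hz k
  refine ⟨l, LinearMap.ext fun w => ?_⟩
  rw [LinearMap.smul_apply, ← map_smul]
  exact hl w

/-- A module without nonzero socle has `J`-divisible dual. -/
theorem mem_smul_top_of_socle_eq_bot [Module.Injective S E] {J : Ideal S} (hJ : J.FG)
    (hW : ∀ w : W, (∀ s ∈ J, s • w = 0) → w = 0) (k : W →ₗ[S] E) :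
    k ∈ J • (⊤ : Submodule S (W →ₗ[S] E)) := by
  classical
  obtain ⟨T, rfl⟩ := hJ
  let φ : W →ₗ[S] (T → W) := LinearMap.pi fun t => LinearMap.lsmul S W t.1
  have hφ : Function.Injective φ := by
    rw [injective_iff_map_eq_zero]
    intro w hw
    refine hW w fun s hs => ?_
    have hT : Submodule.span S (T : Set S) ≤ LinearMap.ker (LinearMap.toSpanSingleton S W w) := by
      rw [Submodule.span_le]
      intro t ht
      exact congrFun hw ⟨t, ht⟩
    exact hT hs
  obtain ⟨h, hh⟩ := Module.Injective.out (R := S) φ hφ k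
  have hk : k = ∑ t : T, t.1 • (h ∘ₗ LinearMap.single S (fun _ : T => W) t) := by
    ext w
    rw [← hh w, LinearMap.sum_apply]
    conv_lhs => rw [← LinearMap.sum_single_apply (fun _ : T => W) (φ w)]
    rw [map_sum]
    refine Finset.sum_congr rfl fun t _ => ?_
    rw [LinearMap.smul_apply, ← map_smul, LinearMap.comp_apply]
    rfl
  rw [hk]
  exact Submodule.sum_mem _ fun t _ =>
    Submodule.smul_mem_smul (Submodule.subset_span t.2) Submodule.mem_top

/-- A module with `J`-divisible dual has no nonzero socle. -/
theorem IsCogenerating.socle_eq_bot (hE : IsCogenerating S E) {J : Ideal S}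
    (h : ∀ k : W →ₗ[S] E, k ∈ J • (⊤ : Submodule S (W →ₗ[S] E))) (w : W)
    (hw : ∀ s ∈ J, s • w = 0) : w = 0 := by
  refine hE W w fun k => ?_
  have := h k
  induction this using Submodule.smul_induction_on' with
  | smul s hs l _ => rw [LinearMap.smul_apply, ← map_smul, hw s hs, map_zero]
  | add a _ b _ ha hb => rw [LinearMap.add_apply, ha, hb, add_zero]

/-- The submodule of elements killed by both `x` and `y`. -/
def kerPair (x y : S) (W : Type) [AddCommGroup W] [Module S W] : Submodule S W :=
  LinearMap.ker (LinearMap.lsmul S W x) ⊓ LinearMap.ker (LinearMap.lsmul S W y)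

theorem mem_kerPair {x y : S} {w : W} : w ∈ kerPair x y W ↔ x • w = 0 ∧ y • w = 0 := Iff.rfl

theorem exists_comp_mkQ_eq {x : S} (k : W →ₗ[S] E) (hk : x • k = 0) :
    ∃ h : QuotSMulTop x W →ₗ[S] E, h ∘ₗ (x • (⊤ : Submodule S W)).mkQ = k := by
  refine ⟨(x • (⊤ : Submodule S W)).liftQ k ?_, Submodule.liftQ_mkQ _ _ _⟩
  intro w hw
  obtain ⟨v, -, rfl⟩ := (Submodule.mem_smul_pointwise_iff_exists _ _ _).1 hw
  rw [LinearMap.mem_ker, map_smul]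
  exact LinearMap.congr_fun hk v

theorem smul_quotSMulTop (x : S) (h : QuotSMulTop x W →ₗ[S] E) : x • h = 0 := by
  ext w
  have : x • (Submodule.Quotient.mk w : QuotSMulTop x W) = 0 := by
    rw [← Submodule.Quotient.mk_smul, Submodule.Quotient.mk_eq_zero]
    exact Submodule.smul_mem_pointwise_smul _ _ _ Submodule.mem_top
  simp only [LinearMap.comp_apply, LinearMap.smul_apply, LinearMap.zero_apply, Submodule.mkQ_apply]
  rw [← map_smul, this, map_zero]

variable (E) in
/-- Homomorphisms from `W ⧸ (x, y) W` are the homomorphisms from `W` killed by `x` and `y`. -/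
theorem exists_quotPairEquiv (x y : S) :
    Nonempty ((QuotSMulTop y (QuotSMulTop x W) →ₗ[S] E) ≃ₗ[S] kerPair x y (W →ₗ[S] E)) := by
  let π : W →ₗ[S] QuotSMulTop y (QuotSMulTop x W) :=
    (y • (⊤ : Submodule S (QuotSMulTop x W))).mkQ ∘ₗ (x • (⊤ : Submodule S W)).mkQ
  have hπ : Function.Surjective π :=
    (Submodule.mkQ_surjective _).comp (Submodule.mkQ_surjective _)
  let Φ : (QuotSMulTop y (QuotSMulTop x W) →ₗ[S] E) →ₗ[S] (W →ₗ[S] E) := LinearMap.lcomp S E π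
  have hΦ : ∀ h, Φ h ∈ kerPair x y (W →ₗ[S] E) := by
    intro h
    refine mem_kerPair.2 ⟨?_, ?_⟩
    · have := smul_quotSMulTop x (h ∘ₗ (y • (⊤ : Submodule S (QuotSMulTop x W))).mkQ)
      exact congrArg (fun l => l ∘ₗ (x • (⊤ : Submodule S W)).mkQ) this
    · rw [← map_smul, smul_quotSMulTop, map_zero]
  refine ⟨LinearEquiv.ofBijective (Φ.codRestrict _ hΦ) ⟨fun a b hab => ?_, fun k => ?_⟩⟩
  · have h1 : a ∘ₗ π = b ∘ₗ π := congrArg Subtype.val hab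
    exact (LinearMap.cancel_right hπ).1 h1
  · obtain ⟨k, hk1, hk2⟩ := k
    obtain ⟨h, rfl⟩ := exists_comp_mkQ_eq k hk1
    obtain ⟨l, rfl⟩ := exists_comp_mkQ_eq (x := y) h (by
      rw [← LinearMap.cancel_right (Submodule.mkQ_surjective (x • (⊤ : Submodule S W)))]
      exact hk2)
    exact ⟨l, rfl⟩

end Duality

section RegularSequenceLocalCohomology

namespace LocCoh

variable {S : Type} [CommRing S] (J : Ideal S) {W : Type} [AddCommGroup W] [Module S W]

theorem subsingleton_quotSMulTop_of_lt {x : S} (hx : IsSMulRegular W x) {k : ℕ}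
    (h : ∀ i < k + 1, Subsingleton (LocCoh J i W)) (i : ℕ) (hi : i < k) :
    Subsingleton (LocCoh J i (QuotSMulTop x W)) := by
  obtain ⟨δ, h1, -⟩ := exists_connecting_smul J i hx
  have := h i (by omega)
  have := h (i + 1) (by omega)
  exact h1.subsingleton_middle

theorem subsingleton_of_quotSMulTop {x : S} (hxJ : x ∈ J) (hx : IsSMulRegular W x) {k : ℕ}
    (h : ∀ i < k, Subsingleton (LocCoh J i (QuotSMulTop x W))) (i : ℕ) (hi : i < k + 1) :
    Subsingleton (LocCoh J i W) := by
  refine subsingleton_of_smul_injective J i hxJ fun a ha => ?_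
  rcases i with _ | i
  · rw [← map_lsmul] at ha
    exact map_zero_injective J (f := LinearMap.lsmul S W x) hx (ha.trans (map_zero _).symm)
  · obtain ⟨δ, -, h2⟩ := exists_connecting_smul J i hx
    obtain ⟨c, rfl⟩ := (h2 a).1 ha
    have := h i (by omega)
    rw [Subsingleton.elim c 0, map_zero]

theorem subsingleton_of_isWeaklyRegular (rs : List S) (hJ : ∀ r ∈ rs, r ∈ J) (W : Type)
    [AddCommGroup W] [Module S W] (h : RingTheory.Sequence.IsWeaklyRegular W rs) :
    ∀ i < rs.length, Subsingleton (LocCoh J i W) := by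
  induction rs generalizing W with
  | nil => intro i hi; simp at hi
  | cons r rs ih =>
    rw [RingTheory.Sequence.isWeaklyRegular_cons_iff] at h
    exact subsingleton_of_quotSMulTop J (hJ r (by simp)) h.1
      (ih (fun s hs => hJ s (by simp [hs])) _ h.2)

theorem socle_eq_bot_of_subsingleton [Subsingleton (LocCoh J 0 W)] (w : W)
    (hw : ∀ s ∈ J, s • w = 0) : w = 0 := by
  obtain ⟨a, rfl⟩ := (mem_range_evalOne_iff J w).2 ⟨1, fun r hr => hw r (by rwa [pow_one] at hr)⟩
  rw [Subsingleton.elim a 0, map_zero]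

/-- If some weakly regular sequence in `J` has length at least three, then dividing by any weakly
regular pair in `J` leaves no socle. -/
theorem socle_quotient_pair_eq_bot {rs : List S} (hrs : ∀ r ∈ rs, r ∈ J)
    (h : RingTheory.Sequence.IsWeaklyRegular W rs) (hl : 3 ≤ rs.length) {x y : S}
    (hx : IsSMulRegular W x) (hy : IsSMulRegular (QuotSMulTop x W) y)
    (w : QuotSMulTop y (QuotSMulTop x W)) (hw : ∀ s ∈ J, s • w = 0) : w = 0 := by
  have h3 : ∀ i < 2 + 1, Subsingleton (LocCoh J i W) := fun i hi =>
    subsingleton_of_isWeaklyRegular J rs hrs W h i (by omega)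
  have := subsingleton_quotSMulTop_of_lt J hy (subsingleton_quotSMulTop_of_lt J hx h3) 0 one_pos
  exact socle_eq_bot_of_subsingleton J w hw

end LocCoh

theorem powTorsion_eq_bot_of_socle_eq_bot {S : Type} [CommRing S] {J : Ideal S} {W : Type}
    [AddCommGroup W] [Module S W] (h : ∀ w : W, (∀ s ∈ J, s • w = 0) → w = 0) :
    powTorsion J W = ⊥ := by
  rw [eq_bot_iff]
  rintro w ⟨k, hk⟩
  rw [Submodule.mem_bot]
  induction k with
  | zero => simpa using hk 1
  | succ k ih =>
    refine ih fun r hr => h _ fun s hs => ?_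
    rw [← mul_smul]
    exact hk _ (by rw [pow_succ']; exact Ideal.mul_mem_mul hs hr)

end RegularSequenceLocalCohomology

section Chase

variable {R : Type} [CommRing R] {J : Ideal R} {A B H : Type} [AddCommGroup A] [Module R A]
  [AddCommGroup B] [Module R B] [AddCommGroup H] [Module R H]
  {α : A →ₗ[R] B} {β : B →ₗ[R] H} {x y z : R}

theorem smul_top_eq_top_of_smul_kerPair (hx : x ∈ J) (hyJ : y ∈ J)
    (hα : ∀ a, α a = 0 ↔ ∃ a', x • a' = a) (hαβ : Function.Exact α β)
    (hβ : ∀ h, x • h = 0 ↔ ∃ b, β b = h) (hy : ∀ b : B, ∃ b', y • b' = b)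
    (hD : J • kerPair x y H = kerPair x y H) : J • (⊤ : Submodule R A) = ⊤ := by
  have hU : ∀ d ∈ kerPair x y H, ∃ b, β b = d ∧ ∃ a ∈ J • (⊤ : Submodule R A), α a = y • b := by
    intro d hd
    rw [← hD] at hd
    induction hd using Submodule.smul_induction_on' with
    | smul r hr d hd =>
      obtain ⟨b, rfl⟩ := (hβ d).1 hd.1
      obtain ⟨a, ha⟩ := (hαβ (y • b)).1 (by rw [map_smul]; exact hd.2)
      refine ⟨r • b, map_smul _ _ _, r • a, Submodule.smul_mem_smul hr Submodule.mem_top, ?_⟩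
      rw [map_smul, ha, smul_comm]
    | add d _ e _ hd he =>
      obtain ⟨b, rfl, a, ha, hab⟩ := hd
      obtain ⟨c, rfl, a', ha', hac⟩ := he
      exact ⟨b + c, map_add _ _ _, a + a', add_mem ha ha', by rw [map_add, hab, hac, smul_add]⟩
  rw [eq_top_iff]
  intro a _
  obtain ⟨b, hb⟩ := hy (α a)
  obtain ⟨b', hb', a', ha', hab⟩ := hU (β b) (mem_kerPair.2 ⟨(hβ _).2 ⟨b, rfl⟩, by
    rw [← map_smul, hb, hαβ.apply_apply_eq_zero]⟩)
  obtain ⟨c, hc⟩ := (hαβ (b - b')).1 (by rw [map_sub, hb', sub_self])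
  obtain ⟨e, he⟩ := (hα (a - a' - y • c)).1 (by
    rw [map_sub, map_sub, map_smul, hc, hab, smul_sub, hb, sub_self])
  have : a = a' + y • c + x • e := by rw [he]; abel
  rw [this]
  exact add_mem (add_mem ha' (Submodule.smul_mem_smul hyJ Submodule.mem_top))
    (Submodule.smul_mem_smul hx Submodule.mem_top)

theorem smul_kerPair_of_smul_top_eq_top (hzJ : z ∈ J) (hαβ : Function.Exact α β)
    (hβ : ∀ h, x • h = 0 ↔ ∃ b, β b = h) (hy : ∀ b : B, ∃ b', y • b' = b)
    (hz : ∀ b : B, y • b = 0 → ∃ b', y • b' = 0 ∧ z • b' = b)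
    (hA : J • (⊤ : Submodule R A) = ⊤) : J • kerPair x y H = kerPair x y H := by
  have hV : ∀ a : A, ∃ b, y • b = α a ∧ β b ∈ J • kerPair x y H := by
    intro a
    have ha : a ∈ J • (⊤ : Submodule R A) := by rw [hA]; exact Submodule.mem_top
    induction ha using Submodule.smul_induction_on' with
    | smul r hr a _ =>
      obtain ⟨b, hb⟩ := hy (α a)
      refine ⟨r • b, by rw [smul_comm, hb, map_smul], ?_⟩
      rw [map_smul]
      exact Submodule.smul_mem_smul hr (mem_kerPair.2 ⟨(hβ _).2 ⟨b, rfl⟩, by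
        rw [← map_smul, hb, hαβ.apply_apply_eq_zero]⟩)
    | add a _ c _ ha hc =>
      obtain ⟨b, hb, hb'⟩ := ha
      obtain ⟨e, he, he'⟩ := hc
      exact ⟨b + e, by rw [smul_add, hb, he, map_add], by rw [map_add]; exact add_mem hb' he'⟩
  refine le_antisymm Submodule.smul_le_right fun d hd => ?_
  obtain ⟨b, rfl⟩ := (hβ d).1 hd.1
  obtain ⟨a, ha⟩ := (hαβ (y • b)).1 (by rw [map_smul]; exact hd.2)
  obtain ⟨b', hb', hb''⟩ := hV a
  obtain ⟨c, hc, hc'⟩ := hz (b - b') (by rw [smul_sub, hb', ha, sub_self])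
  have : β b = z • β c + β b' := by rw [← map_smul, hc', map_sub, sub_add_cancel]
  rw [this]
  exact add_mem (Submodule.smul_mem_smul hzJ (mem_kerPair.2 ⟨(hβ _).2 ⟨c, rfl⟩, by
    rw [← map_smul, hc, map_zero]⟩)) hb''

end Chase

section Transport

variable {R S : Type} [CommRing R] [CommRing S] [Algebra R S] {V W E H : Type}
  [AddCommGroup V] [Module S V] [AddCommGroup W] [Module S W] [AddCommGroup E] [Module S E]
  [AddCommGroup H] [Module R H]

theorem map_smul_top_eq_top_iff (J : Ideal R) (e : V ≃+ H)
    (he : ∀ (r : R) v, e (algebraMap R S r • v) = r • e v) :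
    J.map (algebraMap R S) • (⊤ : Submodule S V) = ⊤ ↔ J • (⊤ : Submodule R H) = ⊤ := by
  let _ : Module R V := Module.compHom V (algebraMap R S)
  have : IsScalarTower R S V := IsScalarTower.of_algebraMap_smul fun _ _ => rfl
  let e' : V ≃ₗ[R] H := { e with map_smul' := he }
  rw [← Submodule.restrictScalars_inj R, Ideal.smul_restrictScalars,
    ← (Submodule.map_injective_of_injective e'.injective).eq_iff, Submodule.map_smul'']
  simp

theorem smul_kerPair_eq_iff (J : Ideal R) (x y : R) :
    J • kerPair x y H = kerPair x y H ↔ J • (⊤ : Submodule R (kerPair x y H)) = ⊤ := by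
  rw [← (Submodule.map_injective_of_injective (kerPair x y H).injective_subtype).eq_iff,
    Submodule.map_smul'']
  simp

theorem exists_quotPairEquiv_of_addEquiv (e : (W →ₗ[S] E) ≃+ H)
    (he : ∀ (r : R) v, e (algebraMap R S r • v) = r • e v) (x y : R) :
    ∃ e' : (QuotSMulTop (algebraMap R S y) (QuotSMulTop (algebraMap R S x) W) →ₗ[S] E) ≃+
      kerPair x y H, ∀ (r : R) v, e' (algebraMap R S r • v) = r • e' v := by
  obtain ⟨f⟩ := exists_quotPairEquiv E (W := W) (algebraMap R S x) (algebraMap R S y)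
  have hk : ∀ v, v ∈ kerPair (algebraMap R S x) (algebraMap R S y) (W →ₗ[S] E) ↔
      e v ∈ kerPair x y H := by
    intro v
    rw [mem_kerPair, mem_kerPair, ← he, ← he, e.map_eq_zero_iff, e.map_eq_zero_iff]
  let g : kerPair (algebraMap R S x) (algebraMap R S y) (W →ₗ[S] E) ≃+ kerPair x y H :=
    { toEquiv := e.toEquiv.subtypeEquiv hk
      map_add' := fun a b => Subtype.ext (map_add e a.1 b.1) }
  refine ⟨f.toAddEquiv.trans g, fun r v => Subtype.ext ?_⟩
  change e (f (algebraMap R S r • v)).1 = r • e (f v).1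
  rw [map_smul, ← he]
  rfl

theorem isSMulRegular_of_surjective (hE : IsCogenerating S E) (e : (W →ₗ[S] E) ≃+ H)
    (he : ∀ (r : R) v, e (algebraMap R S r • v) = r • e v) {z : R}
    (hz : ∀ h : H, ∃ h', z • h' = h) : IsSMulRegular W (algebraMap R S z) := by
  refine hE.isSMulRegular fun k => ?_
  obtain ⟨h, hh⟩ := hz (e k)
  refine ⟨e.symm h, e.injective ?_⟩
  rw [he, e.apply_symm_apply, hh]

theorem isSMulRegular_quotSMulTop_of_surjective (hE : IsCogenerating S E) (e : (W →ₗ[S] E) ≃+ H)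
    (he : ∀ (r : R) v, e (algebraMap R S r • v) = r • e v) {x y : R}
    (hy : ∀ h : H, x • h = 0 → ∃ h', x • h' = 0 ∧ y • h' = h) :
    IsSMulRegular (QuotSMulTop (algebraMap R S x) W) (algebraMap R S y) := by
  refine hE.isSMulRegular fun k => ?_
  let π := (algebraMap R S x • (⊤ : Submodule S W)).mkQ
  obtain ⟨h, hh, hh'⟩ := hy (e (k ∘ₗ π)) (by
    rw [← he, e.map_eq_zero_iff]
    exact congrArg (fun l => l ∘ₗ π) (smul_quotSMulTop _ k))
  obtain ⟨l, hl⟩ := exists_comp_mkQ_eq (x := algebraMap R S x) (e.symm h) (e.injective (by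
    rw [he, e.apply_symm_apply, hh, map_zero]))
  refine ⟨l, (LinearMap.cancel_right (Submodule.mkQ_surjective _)).1 (e.injective ?_)⟩
  rw [LinearMap.smul_comp, hl, he, e.apply_symm_apply, hh']

end Transport

theorem IsInjHull.isCogenerating {S E : Type} [CommRing S] [IsLocalRing S] [AddCommGroup E]
    [Module S E] (h : IsInjHull S (maximalIdeal S) E) : IsCogenerating S E := by
  obtain ⟨_, f, hf, -⟩ := h
  intro W _ _ w hw
  by_contra hw0
  obtain ⟨k, hk⟩ := exists_linearMap_apply_ne_zero f hf hw0
  exact hk (hw k)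

theorem maximalIdeal_mem_attachedPrimes_iff {R A : Type} [CommRing R] [IsLocalRing R]
    [AddCommGroup A] [Module R A] :
    maximalIdeal R ∈ attachedPrimes R A ↔ maximalIdeal R • (⊤ : Submodule R A) ≠ ⊤ := by
  refine ⟨fun ⟨_, N, hN⟩ h => ?_, fun h => ⟨inferInstance, maximalIdeal R • ⊤, ?_⟩⟩
  · have hNtop : N = ⊤ := top_le_iff.1 <| h ▸ Submodule.smul_le.2 fun r hr a _ => by
      rw [hN, Module.mem_annihilator] at hr
      simpa [← Submodule.Quotient.mk_smul] using hr (Submodule.Quotient.mk a)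
    rw [Module.annihilator_eq_top_iff.2 (Submodule.Quotient.subsingleton_iff.2 hNtop)] at hN
    exact (maximalIdeal.isMaximal R).ne_top hN
  · refine (maximalIdeal.isMaximal R).eq_of_le (fun h' => h ?_) fun r hr => ?_
    · exact Submodule.Quotient.subsingleton_iff.1 (Module.annihilator_eq_top_iff.1 h')
    · rw [Module.mem_annihilator]
      rintro ⟨a⟩
      exact (Submodule.Quotient.mk_eq_zero _).2 (Submodule.smul_mem_smul hr Submodule.mem_top)

theorem exists_isSMulRegular_of_one_le_gradeI {S M : Type} [CommRing S] {J : Ideal S}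
    [AddCommGroup M] [Module S M] (h : 1 ≤ gradeI S J M) : ∃ x ∈ J, IsSMulRegular M x := by
  obtain ⟨n, ⟨rs, hn, hJ, hrs⟩, hn0⟩ := lt_sSup_iff.1 (zero_lt_one.trans_le h)
  rcases rs with _ | ⟨r, rs⟩
  · simp [← hn] at hn0
  · exact ⟨r, hJ r (by simp),
      ((RingTheory.Sequence.isWeaklyRegular_cons_iff M r rs).1 hrs.toIsWeaklyRegular).1⟩

section

variable {R S : Type} [CommRing R] [IsNoetherianRing R] [IsLocalRing R] [CommRing S]
  [IsLocalRing S] [Algebra R S] {W E W₀ E₀ H : Type} [AddCommGroup W] [Module S W]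
  [Module.Finite S W] [AddCommGroup E] [Module S E] [AddCommGroup W₀] [Module R W₀]
  [Module.Finite R W₀] [AddCommGroup E₀] [Module R E₀] [AddCommGroup H] [Module R H]
  {x y : R}

/-- Divisibility of the joint kernel of `x` and `y` by the maximal ideal gives an element of the
maximal ideal that divides it. -/
theorem exists_smul_surjective_kerPair (hE₀ : IsInjHull R (maximalIdeal R) E₀)
    (e₀ : (W₀ →ₗ[R] E₀) ≃ₗ[R] H)
    (h : maximalIdeal R • kerPair x y H = kerPair x y H) :
    ∃ z ∈ maximalIdeal R, ∀ k : kerPair x y H, ∃ k', z • k' = k := by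
  have := hE₀.1
  obtain ⟨e, he⟩ := exists_quotPairEquiv_of_addEquiv (S := R) e₀.toAddEquiv
    (fun r v => e₀.map_smul r v) x y
  have htop := (map_smul_top_eq_top_iff (maximalIdeal R) e he).2
    ((smul_kerPair_eq_iff _ x y).1 h)
  rw [Algebra.algebraMap_self, Ideal.map_id] at htop
  obtain ⟨z, hz, hzW⟩ := exists_isSMulRegular_of_powTorsion_eq_bot _
    (powTorsion_eq_bot_of_socle_eq_bot (hE₀.isCogenerating.socle_eq_bot
      fun k => htop ▸ Submodule.mem_top))
  refine ⟨z, hz, fun k => ?_⟩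
  obtain ⟨l, hl⟩ := exists_smul_eq_of_isSMulRegular hzW (e.symm k)
  exact ⟨e l, (he z l).symm.trans ((congrArg e hl).trans (e.apply_symm_apply k))⟩

theorem gradeI_eq_two_iff (hS : maximalIdeal S = (maximalIdeal R).map (algebraMap R S))
    (hE : IsInjHull S (maximalIdeal S) E) (hE₀ : IsInjHull R (maximalIdeal R) E₀)
    (e₀ : (W₀ →ₗ[R] E₀) ≃ₗ[R] H) (e : (W →ₗ[S] E) ≃+ H)
    (he : ∀ (r : R) v, e (algebraMap R S r • v) = r • e v)
    (hxm : x ∈ maximalIdeal R) (hym : y ∈ maximalIdeal R) (hx : ∀ h : H, ∃ h', x • h' = h)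
    (hy : ∀ h : H, x • h = 0 → ∃ h', x • h' = 0 ∧ y • h' = h) :
    gradeI S (maximalIdeal S) W = 2 ↔ maximalIdeal R • kerPair x y H ≠ kerPair x y H := by
  have := hE.1
  have hmem : ∀ r ∈ maximalIdeal R, algebraMap R S r ∈ maximalIdeal S := fun r hr =>
    hS ▸ Ideal.mem_map_of_mem _ hr
  have hxW := isSMulRegular_of_surjective hE.isCogenerating e he hx
  have hyW := isSMulRegular_quotSMulTop_of_surjective hE.isCogenerating e he hy
  obtain ⟨e', he'⟩ := exists_quotPairEquiv_of_addEquiv e he x y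
  constructor
  · intro h2 h
    have : Nontrivial W := by
      by_contra hW
      rw [not_nontrivial_iff_subsingleton] at hW
      have : gradeI S (maximalIdeal S) W ≤ 0 := sSup_le <| by
        rintro _ ⟨rs, -, -, hrs⟩
        exact (hrs.top_ne_smul (Subsingleton.elim _ _)).elim
      rw [h2] at this
      exact absurd this (by decide)
    obtain ⟨z, hz, hzK⟩ := exists_smul_surjective_kerPair hE₀ e₀ h
    have hzW := isSMulRegular_of_surjective hE.isCogenerating e' he' hzK
    have h3 : (3 : ℕ∞) ≤ gradeI S (maximalIdeal S) W := by
      have hrs : ∀ r ∈ [algebraMap R S x, algebraMap R S y, algebraMap R S z],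
          r ∈ maximalIdeal S := by
        simp only [List.forall_mem_cons]
        exact ⟨hmem x hxm, hmem y hym, hmem z hz, by simp⟩
      refine le_sSup ⟨_, rfl, hrs,
        (isRegular_iff_isWeaklyRegular_of_subset_maximalIdeal hrs).2 ?_⟩
      simp only [RingTheory.Sequence.isWeaklyRegular_cons_iff]
      exact ⟨hxW, hyW, hzW, RingTheory.Sequence.IsWeaklyRegular.nil _ _⟩
    rw [h2] at h3
    exact absurd h3 (by decide)
  · intro h
    have : Nontrivial W := by
      by_contra hW
      rw [not_nontrivial_iff_subsingleton] at hW
      have : Subsingleton H := e.symm.injective.subsingleton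
      exact h (Subsingleton.elim _ _)
    refine le_antisymm (sSup_le ?_) ?_
    · rintro _ ⟨rs, rfl, hrs, hreg⟩
      by_contra! hl
      have hl : 3 ≤ rs.length := by exact_mod_cast Order.add_one_le_of_lt hl
      refine h ((smul_kerPair_eq_iff _ x y).2 ((map_smul_top_eq_top_iff _ e' he').1 ?_))
      rw [← hS, eq_top_iff]
      have hfg : (maximalIdeal S).FG := hS ▸
        Ideal.FG.map (IsNoetherian.noetherian (maximalIdeal R)) _
      exact fun k _ => mem_smul_top_of_socle_eq_bot hfg
        (LocCoh.socle_quotient_pair_eq_bot _ hrs hreg.toIsWeaklyRegular hl hxW hyW) k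
    · have hrs : ∀ r ∈ [algebraMap R S x, algebraMap R S y], r ∈ maximalIdeal S := by
        simp only [List.forall_mem_cons]
        exact ⟨hmem x hxm, hmem y hym, by simp⟩
      refine le_sSup ⟨_, rfl, hrs,
        (isRegular_iff_isWeaklyRegular_of_subset_maximalIdeal hrs).2 ?_⟩
      simp only [RingTheory.Sequence.isWeaklyRegular_cons_iff]
      exact ⟨hxW, hyW, RingTheory.Sequence.IsWeaklyRegular.nil _ _⟩

end

/-- Whether the maximal ideal divides the local cohomology just below the top can be read off from
the joint kernel of a suitable pair of elements on the top local cohomology. -/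
theorem LocCoh.exists_smul_top_eq_top_iff {R : Type} [CommRing R] [IsNoetherianRing R]
    [IsLocalRing R] {j : ℕ} {M : Type} [AddCommGroup M] [Module R M] [Module.Finite R M]
    (hM : Module.supportDim R M < ((j + 4 : ℕ) : WithBot ℕ∞)) {x : R} (hxm : x ∈ maximalIdeal R)
    (hx : IsSMulRegular M x) :
    ∃ y ∈ maximalIdeal R, (∀ h : LocCoh (maximalIdeal R) (j + 3) M, ∃ h', x • h' = h) ∧
      (∀ h : LocCoh (maximalIdeal R) (j + 3) M, x • h = 0 → ∃ h', x • h' = 0 ∧ y • h' = h) ∧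
      (maximalIdeal R • (⊤ : Submodule R (LocCoh (maximalIdeal R) (j + 2) M)) = ⊤ ↔
        maximalIdeal R • kerPair x y (LocCoh (maximalIdeal R) (j + 3) M) =
          kerPair x y (LocCoh (maximalIdeal R) (j + 3) M)) := by
  have hN := supportDim_quotient_lt hxm hx hM
  have := subsingleton_of_supportDim_lt (j + 3) _ hN (j + 3) le_rfl
  obtain ⟨y, hym, z, hzm, hy, hz⟩ := exists_smul_surjective_pair j _ hN
  obtain ⟨δ, hexact, hδ⟩ := exists_connecting_smul (maximalIdeal R) (j + 2) hx
  refine ⟨y, hym, smul_surjective_of_subsingleton _ _ hx, fun h hh => ?_,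
    smul_kerPair_of_smul_top_eq_top hzm hexact hδ hy hz,
    smul_top_eq_top_of_smul_kerPair hxm hym (exact_smul_map _ _ hx) hexact hδ hy⟩
  obtain ⟨b, rfl⟩ := (hδ h).1 hh
  obtain ⟨b', rfl⟩ := hy b
  exact ⟨δ b', (hδ _).2 ⟨b', rfl⟩, (map_smul δ y b').symm⟩

theorem stmt4 (R : Type) [CommRing R] [IsNoetherianRing R] [IsLocalRing R]
    (d' : ℕ) (hd' : 3 ≤ d') (M : ModuleCat R) (hM : Module.Finite R ↥M)
    (hdim : mdim R ↥M = (d' : WithBot ℕ∞))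
    (hdepth : 1 ≤ gradeI R (maximalIdeal R) ↥M)
    (hcan : ∃ ω : ModuleCat R, IsCanonicalModule R (maximalIdeal R) d' M ω) :
    ∀ ω' : ModuleCat (AdicCompletion (maximalIdeal R) R),
      IsCanonicalModule (AdicCompletion (maximalIdeal R) R)
        ((maximalIdeal R).map (algebraMap R (AdicCompletion (maximalIdeal R) R))) d'
        (ModuleCat.of (AdicCompletion (maximalIdeal R) R)
          (AdicCompletion (maximalIdeal R) ↥M)) ω' →
      ((maximalIdeal R) ∈ attachedPrimes R ↥(LC R (maximalIdeal R) (d' - 1) M) ↔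
        gradeI (AdicCompletion (maximalIdeal R) R)
          ((maximalIdeal R).map (algebraMap R (AdicCompletion (maximalIdeal R) R)))
          ↥ω' = 2) := by
  rintro ω' ⟨_, E, hE, ⟨f⟩⟩
  obtain ⟨ω, _, E₀, hE₀, ⟨f₀⟩⟩ := hcan
  obtain ⟨n, g, hg⟩ := Module.Finite.exists_fin' R ω
  let g' : (((Fin n → R) ⧸ LinearMap.ker g) →ₗ[R] E₀) ≃ₗ[R] (ω →ₗ[R] E₀) :=
    (g.quotKerEquivOfSurjective hg).arrowCongr (LinearEquiv.refl R E₀)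
  obtain ⟨j, rfl⟩ : ∃ j, d' = j + 3 := ⟨d' - 3, by omega⟩
  have hdim' : Module.supportDim R M < ((j + 4 : ℕ) : WithBot ℕ∞) := by
    refine lt_of_eq_of_lt hdim ?_
    exact_mod_cast Nat.lt_succ_self _
  have hS := AdicCompletion.maximalIdeal_eq_map (R := R)
  obtain ⟨x, hxm, hx⟩ := exists_isSMulRegular_of_one_le_gradeI hdepth
  obtain ⟨y, hym, hxH, hyH, hiff⟩ := LocCoh.exists_smul_top_eq_top_iff hdim' hxm hx
  obtain ⟨u⟩ := nonempty_locCoh_equiv (maximalIdeal R) (j + 2) M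
  obtain ⟨u₀⟩ := nonempty_locCoh_equiv (maximalIdeal R) (j + 3) M
  obtain ⟨u'⟩ := nonempty_locCoh_equiv
    ((maximalIdeal R).map (algebraMap R (AdicCompletion (maximalIdeal R) R))) (j + 3)
    (ModuleCat.of (AdicCompletion (maximalIdeal R) R) (AdicCompletion (maximalIdeal R) M))
  obtain ⟨c, hc⟩ := LocCoh.exists_completion_equiv M hdim' (j + 2)
  have hu : maximalIdeal R • (⊤ : Submodule R (LocCoh (maximalIdeal R) (j + 2) M)) = ⊤ ↔
      maximalIdeal R • (⊤ : Submodule R (LC R (maximalIdeal R) (j + 2) M)) = ⊤ := by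
    simpa using map_smul_top_eq_top_iff (S := R) (maximalIdeal R) u.toAddEquiv
      fun r v => u.map_smul r v
  rw [maximalIdeal_mem_attachedPrimes_iff, show j + 3 - 1 = j + 2 from rfl, ← hS, Ne, ← hu, hiff]
  refine (gradeI_eq_two_iff hS (hS ▸ hE) hE₀ (g'.trans (f₀.trans u₀.symm))
    ((f.trans u'.symm).toAddEquiv.trans c) (fun r v => ?_) hxm hym hxH hyH).symm
  exact (congrArg c ((f.trans u'.symm).map_smul _ v)).trans (hc r _)
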